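/- arXiv:1711.07053 — 2 statements merged into one kernel-verified Lean document; each statement's English description precedes it below -/
import Mathlib

section
/- A sequence ⟨n_i : i ∈ I⟩ of positive natural numbers is reversible if and only if the set K = {m ∈ ℕ : the set {i ∈ I : n_i = m} is infinite} is an independent subset of ℕ and, whenever K is nonempty, gcd(K) divides at most finitely many elements of the set {n_i : i ∈ I}. -/
/-- A sequence of (positive) natural numbers is reversible iff there is no non-injective
surjection f : I → I such that for all j, the sum of n_i over the fiber f⁻¹[{j}] equals n_j. -/
def RevSeqNat {I : Type*} (n : I → ℕ) : Prop :=
  ¬ ∃ f : I → I, Function.Surjective f ∧ ¬ Function.Injective f ∧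
      ∀ j, ∑ᶠ i ∈ f ⁻¹' {j}, n i = n j

/-- A set K of naturals is independent iff no element of K belongs to the additive
subsemigroup generated by the other elements of K. -/
def IndepSet (K : Set ℕ) : Prop :=
  ∀ m ∈ K, m ∉ AddSubsemigroup.closure (K \ {m})

/-- The infinite values. -/
def infVals {I : Type*} (n : I → ℕ) : Set ℕ := {m : ℕ | {i | n i = m}.Infinite}

lemma equiv_sum {I E : Type*} [Countable E] (n : I → ℕ) (nE : E → ℕ)
    (hE : ∀ x, nE x ∈ infVals n) :
    ∃ e : (I ⊕ E) ≃ I, ∀ x, n (e x) = Sum.elim n nE x := by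
  have key : ∀ m, Nonempty ({x : I ⊕ E // Sum.elim n nE x = m} ≃ {i // n i = m}) := by
    intro m
    have e1 : {x : I ⊕ E // Sum.elim n nE x = m} ≃ {i // n i = m} ⊕ {x // nE x = m} :=
      Equiv.subtypeSum
    by_cases hm : m ∈ infVals n
    · have : Infinite {i // n i = m} := Set.infinite_coe_iff.mpr hm
      have h2 : Nonempty (({i // n i = m} ⊕ {x // nE x = m}) ≃ {i // n i = m}) := by
        rw [← Cardinal.lift_mk_eq']
        simp only [Cardinal.mk_sum, Cardinal.lift_add, Cardinal.lift_lift]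
        rw [Cardinal.add_eq_left]
        · simp
        · refine le_trans (b := Cardinal.aleph0) ?_ ?_
          · simp
          · simp
      exact h2.map fun e2 => e1.trans e2
    · have : IsEmpty {x // nE x = m} := ⟨fun x => hm (x.2 ▸ hE x.1)⟩
      exact ⟨e1.trans (Equiv.sumEmpty _ _)⟩
  choose e he using fun m => (key m).elim fun e => (⟨e, trivial⟩ : ∃ _ : _ ≃ _, True)
  refine ⟨(Equiv.sigmaFiberEquiv (Sum.elim n nE)).symm.trans
    ((Equiv.sigmaCongrRight e).trans (Equiv.sigmaFiberEquiv n)), fun x => ?_⟩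
  exact (e _ ⟨x, rfl⟩).2

open Classical in
lemma not_rev {I : Type*} (n : I → ℕ) (hpos : ∀ i, 0 < n i) (b : ℕ → I)
    (hb : Function.Injective b) (L : ℕ → List ℕ) (hL : ∀ t, ∀ x ∈ L t, x ∈ infVals n)
    (h0 : (L 0).sum = n (b 0)) (hs : ∀ t, n (b (t+1)) = n (b t) + (L (t+1)).sum)
    (hn : 2 ≤ (L 0).length ∨ L 1 ≠ []) : ¬ RevSeqNat n := by
  unfold RevSeqNat
  rw [not_not]
  let E := Σ t : ℕ, Fin (L t).length
  let nE : E → ℕ := fun x => (L x.1).get x.2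
  obtain ⟨e, he⟩ := equiv_sum n nE (fun x => hL x.1 _ (List.get_mem _ _))
  let sh : I → I := fun i => if h : ∃ t, b t = i then b (h.choose + 1) else i
  have shb : ∀ t, sh (b t) = b (t+1) := by
    intro t
    have h : ∃ t', b t' = b t := ⟨t, rfl⟩
    simp only [sh, dif_pos h]
    rw [hb h.choose_spec]
  have shn : ∀ i, (∀ t, b t ≠ i) → sh i = i := by
    intro i hi
    simp only [sh]
    rw [dif_neg (by push Not; exact hi)]
  let g : I ⊕ E → I := Sum.elim sh (fun x => b x.1)
  have Lsum : ∀ t, ∑ p : Fin (L t).length, nE ⟨t, p⟩ = (L t).sum := by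
    intro t
    simp only [nE]
    simp
  have main : ∀ j, ∃ F : Finset (I ⊕ E), (∀ x, x ∈ F ↔ g x = j) ∧
      ∑ x ∈ F, Sum.elim n nE x = n j := by
    intro j
    by_cases hj : ∃ t, b t = j
    · obtain ⟨t, rfl⟩ := hj
      let U : Finset E := Finset.univ.map (Function.Embedding.sigmaMk (β := fun t => Fin (L t).length) t)
      have hU : ∀ x : E, x ∈ U ↔ b x.1 = b t := by
        rintro ⟨s, p⟩
        simp only [U, Finset.mem_map, Finset.mem_univ, true_and]
        constructor
        · rintro ⟨a, ha⟩
          cases ha; rfl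
        · intro h
          cases hb h
          exact ⟨p, rfl⟩
      have hUs : ∑ x ∈ U, nE x = (L t).sum := by
        rw [← Lsum, Finset.sum_map]; rfl
      cases t with
      | zero =>
        refine ⟨Finset.disjSum ∅ U, ?_, ?_⟩
        · rintro (i | x)
          · simp only [Finset.inl_mem_disjSum, Finset.notMem_empty, false_iff]
            simp only [g, Sum.elim_inl]
            intro h
            by_cases hi : ∃ t, b t = i
            · obtain ⟨t, rfl⟩ := hi
              rw [shb] at h
              exact absurd (hb h) (by simp)
            · push Not at hi
              rw [shn i hi] at h
              exact hi 0 h.symm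
          · rw [Finset.inr_mem_disjSum, hU]; rfl
        · rw [Finset.sum_disjSum]; simpa [hUs] using h0
      | succ t =>
        refine ⟨Finset.disjSum {b t} U, ?_, ?_⟩
        · rintro (i | x)
          · simp only [Finset.inl_mem_disjSum, Finset.mem_singleton]
            simp only [g, Sum.elim_inl]
            constructor
            · rintro rfl; exact shb t
            intro h
            by_cases hi : ∃ t, b t = i
            · obtain ⟨s, rfl⟩ := hi
              rw [shb] at h
              have := hb h
              congr 1; omega
            · push Not at hi
              rw [shn i hi] at h
              exact absurd h.symm (hi _)
          · rw [Finset.inr_mem_disjSum, hU]; rfl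
        · rw [Finset.sum_disjSum]; simp [hUs, hs]
    · push Not at hj
      refine ⟨Finset.disjSum {j} ∅, ?_, ?_⟩
      · rintro (i | x)
        · simp only [Finset.inl_mem_disjSum, Finset.mem_singleton]
          simp only [g, Sum.elim_inl]
          constructor
          · rintro rfl; exact shn _ hj
          intro h
          by_cases hi : ∃ t, b t = i
          · obtain ⟨s, rfl⟩ := hi
            rw [shb] at h
            exact absurd h (hj _)
          · push Not at hi
            rwa [shn i hi] at h
        · simp only [Finset.inr_mem_disjSum, Finset.notMem_empty, false_iff]
          exact hj _
      · rw [Finset.sum_disjSum]; simp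
  have hsum : ∀ j, ∑ᶠ i ∈ (g ∘ e.symm) ⁻¹' {j}, n i = n j := by
    intro j
    obtain ⟨F, hF, hFs⟩ := main j
    have : (g ∘ e.symm) ⁻¹' {j} = ↑(F.map e.toEmbedding) := by
      ext i
      simp only [Set.mem_preimage, Function.comp, Set.mem_singleton_iff, Finset.coe_map,
        Set.mem_image, Finset.mem_coe, hF]
      constructor
      · intro h; exact ⟨_, h, by simp⟩
      · rintro ⟨x, hx, rfl⟩; simpa using hx
    rw [this, finsum_mem_coe_finset, Finset.sum_map, ← hFs]
    exact Finset.sum_congr rfl fun x _ => he x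
  refine ⟨g ∘ e.symm, ?_, ?_, hsum⟩
  · intro j
    obtain ⟨F, hF, hFs⟩ := main j
    have : F.Nonempty := by
      rw [Finset.nonempty_iff_ne_empty]
      rintro rfl
      have := hpos j
      simp at hFs; omega
    obtain ⟨x, hx⟩ := this
    exact ⟨e x, by simpa using (hF x).1 hx⟩
  · intro hinj
    have ginj : Function.Injective g := by
      have := hinj.comp e.injective
      intro x y hxy
      apply this
      simpa using hxy
    rcases hn with h | h
    · have := @ginj (Sum.inr ⟨0, ⟨0, by omega⟩⟩) (Sum.inr ⟨0, ⟨1, by omega⟩⟩) rfl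
      have h5 := eq_of_heq (Sigma.mk.inj (Sum.inr.inj this)).2
      simp at h5
    · have hl : 0 < (L 1).length := List.length_pos_iff.mpr h
      have := @ginj (Sum.inl (b 0)) (Sum.inr ⟨1, ⟨0, hl⟩⟩) (shb 0)
      simp at this

lemma semi_list {K : Set ℕ} {m : ℕ} (h : m ∈ AddSubsemigroup.closure K) :
    ∃ l : List ℕ, l ≠ [] ∧ (∀ x ∈ l, x ∈ K) ∧ l.sum = m := by
  induction h using AddSubsemigroup.closure_induction with
  | mem x hx => exact ⟨[x], by simp, by simpa using hx, by simp⟩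
  | add x y _ _ hx hy =>
    obtain ⟨l, h1, h2, h3⟩ := hx
    obtain ⟨l', h1', h2', h3'⟩ := hy
    refine ⟨l ++ l', by simp [h1], ?_, by simp [h3, h3']⟩
    intro x hx
    rcases List.mem_append.1 hx with h | h
    exacts [h2 x h, h2' x h]

lemma fwd_indep {I : Type*} (n : I → ℕ) (hpos : ∀ i, 0 < n i) (h : RevSeqNat n) :
    IndepSet (infVals n) := by
  intro k hk hc
  obtain ⟨l, h1, h2, h3⟩ := semi_list hc
  have hk' : {i | n i = k}.Infinite := hk
  let b := hk'.natEmbedding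
  refine not_rev n hpos (fun t => (b t : I)) (fun s t hst => b.injective (Subtype.ext hst))
    (fun t => if t = 0 then l else []) ?_ ?_ ?_ (Or.inl ?_) h
  · intro t x hx
    by_cases ht : t = 0
    · simp only [ht, if_true] at hx
      exact (h2 x hx).1
    · simp [ht] at hx
  · simp only [if_true, h3]; exact (b 0).2.symm
  · intro t
    have e1 : n (b (t+1)) = k := (b (t+1)).2
    have e2 : n (b t) = k := (b t).2
    simp [e1, e2]
  · simp only [if_true]
    match l, h1, h2, h3 with
    | [x], _, h2, h3 =>
      exact absurd (by simpa using h3) (h2 x (by simp)).2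
    | x :: y :: l, _, _, _ => simp

lemma fwd_gcd {I : Type*} (n : I → ℕ) (hpos : ∀ i, 0 < n i) (h : RevSeqNat n) :
    {m ∈ Set.range n | Nat.setGcd (infVals n) ∣ m}.Finite := by
  by_contra hV
  have hV : {m ∈ Set.range n | Nat.setGcd (infVals n) ∣ m}.Infinite := hV
  obtain ⟨N, hN⟩ := Nat.exists_mem_closure_of_ge (infVals n)
  have step : ∀ x : ℕ, ∃ i : I, x < n i ∧ Nat.setGcd (infVals n) ∣ n i := by
    intro x
    obtain ⟨m, ⟨⟨i, rfl⟩, hd⟩, hm⟩ := hV.exists_gt x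
    exact ⟨i, hm, hd⟩
  choose nx hnx hnd using step
  let b : ℕ → I := fun t => Nat.rec (nx N) (fun _ i => nx (n i + N)) t
  have bs : ∀ t, b (t+1) = nx (n (b t) + N) := fun t => rfl
  have bd : ∀ t, Nat.setGcd (infVals n) ∣ n (b t) := by
    intro t; cases t with
    | zero => exact hnd _
    | succ t => exact hnd _
  have blt : ∀ t, n (b t) + N < n (b (t+1)) := fun t => by rw [bs]; exact hnx _
  have bmono : StrictMono (fun t => n (b t)) :=
    strictMono_nat_of_lt_succ fun t => by have := blt t; omega
  have hl0 := AddSubmonoid.exists_list_of_mem_closure (hN (n (b 0)) (hnx N).le (bd 0))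
  have hl : ∀ t, _ := fun t => AddSubmonoid.exists_list_of_mem_closure
    (hN (n (b (t+1)) - n (b t)) (by have := blt t; omega) (Nat.dvd_sub (bd (t+1)) (bd t)))
  obtain ⟨l0, h1, h2⟩ := hl0
  choose l hl1 hl2 using hl
  refine not_rev n hpos b (fun s t hst => bmono.injective (congrArg n hst))
    (fun t => Nat.casesOn t l0 l) ?_ h2 ?_ (Or.inr ?_) h
  · intro t; cases t with
    | zero => exact h1
    | succ t => exact hl1 t
  · intro t
    have := blt t
    have := hl2 t
    simp only
    omega
  · have := blt 0
    have h3 := hl2 0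
    intro h4
    replace h4 : l 0 = [] := h4
    rw [h4] at h3
    simp only [List.sum_nil] at h3
    omega

lemma semi_lt {K : Set ℕ} (k : ℕ) {x : ℕ} (h : x ∈ AddSubsemigroup.closure K) :
    x ∈ AddSubsemigroup.closure (K \ {k}) ∨ k ≤ x := by
  induction h using AddSubsemigroup.closure_induction with
  | mem x hx =>
    by_cases hxk : x = k
    · right; omega
    · left; exact AddSubsemigroup.subset_closure ⟨hx, hxk⟩
  | add x y _ _ hx hy =>
    rcases hx with hx | hx
    · rcases hy with hy | hy
      · left; exact add_mem hx hy
      · right; omega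
    · right; omega

lemma sum_semi {I : Type*} (n : I → ℕ) (S : AddSubsemigroup ℕ) (F : Finset I) (hF : F.Nonempty)
    (h : ∀ i ∈ F, n i ∈ S) : ∑ i ∈ F, n i ∈ S := by
  classical
  induction hF using Finset.Nonempty.cons_induction with
  | singleton a => simpa using h
  | cons a s ha hs ih =>
    rw [Finset.sum_cons]
    exact add_mem (h a (by simp)) (ih fun i hi => h i (by simp [hi]))

lemma bwd {I : Type*} (n : I → ℕ) (hpos : ∀ i, 0 < n i) (hind : IndepSet (infVals n))
    (hgcd : (infVals n).Nonempty → {m ∈ Set.range n | Nat.setGcd (infVals n) ∣ m}.Finite) :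
    RevSeqNat n := by
  classical
  rintro ⟨f, hsurj, hninj, hsum⟩
  apply hninj
  have hF : ∀ j, ∃ F : Finset I, (∀ i, i ∈ F ↔ f i = j) ∧ ∑ i ∈ F, n i = n j := by
    intro j
    have hfin : (f ⁻¹' {j}).Finite := by
      by_contra hinf
      have := hsum j
      rw [finsum_mem_eq_zero_of_infinite] at this
      · have := hpos j; omega
      · rwa [Function.support_eq_univ fun i => (hpos i).ne', Set.inter_univ]
    refine ⟨hfin.toFinset, by simp, ?_⟩
    rw [← hsum j, finsum_mem_eq_finite_toFinset_sum _ hfin]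
  choose F hFm hFs using hF
  have hne : ∀ j, (F j).Nonempty := fun j => by
    obtain ⟨i, hi⟩ := hsurj j
    exact ⟨i, (hFm j i).2 hi⟩
  have hle : ∀ i, n i ≤ n (f i) := fun i => by
    rw [← hFs (f i)]
    exact Finset.single_le_sum (f := n) (fun _ _ => Nat.zero_le _) ((hFm _ _).2 rfl)
  have hsing : ∀ i, n i = n (f i) → F (f i) = {i} := by
    intro i hi
    have hm : i ∈ F (f i) := (hFm _ _).2 rfl
    have h1 := Finset.add_sum_erase (F (f i)) n hm
    rw [hFs] at h1
    have h2 : ∑ x ∈ (F (f i)).erase i, n x = 0 := by omega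
    rw [Finset.sum_eq_zero_iff] at h2
    ext x
    rw [Finset.mem_singleton]
    constructor
    · intro hx
      by_contra hxi
      have := h2 x (Finset.mem_erase.2 ⟨hxi, hx⟩)
      have := hpos x
      omega
    · rintro rfl; exact hm
  set K := infVals n with hK
  set S := AddSubsemigroup.closure K with hS
  have hKS : ∀ m ∈ K, m ∈ S := fun m hm => AddSubsemigroup.subset_closure hm
  have hfib : ∀ m, m ∉ K → {i | n i = m}.Finite := fun m hm => Set.not_infinite.1 hm
  -- step 1
  have step1 : ∀ j, n j ∉ S → ∃ i, n i ∉ S ∧ f i = j := by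
    intro j hj
    by_contra hcon
    push Not at hcon
    apply hj
    rw [← hFs j]
    refine sum_semi n S _ (hne j) fun i hi => ?_
    by_contra h
    exact hcon i h ((hFm _ _).1 hi)
  have hAfin : ∀ m, {i | n i ∉ S ∧ n i ≤ m}.Finite := by
    intro m
    refine Set.Finite.subset (s := ⋃ v ∈ {v | v ≤ m ∧ v ∉ K}, {i | n i = v}) ?_ ?_
    · refine Set.Finite.biUnion ((Set.finite_Iic m).subset fun v hv => hv.1) fun v hv => hfib v hv.2
    · intro i hi
      simp only [Set.mem_iUnion]
      exact ⟨n i, ⟨hi.2, fun h => hi.1 (hKS _ h)⟩, rfl⟩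
  have hP : ∀ j, n j ∉ S → ∃ i, n i ∉ S ∧ f i = j ∧ n i = n j ∧ F j = {i} := by
    intro j hj
    let A := (hAfin (n j)).toFinset
    have hA : ∀ i, i ∈ A ↔ n i ∉ S ∧ n i ≤ n j := by intro i; simp [A]
    choose! σ hσ1 hσ2 using step1
    have hmaps : ∀ a ∈ A, σ a ∈ A := by
      intro a ha
      rw [hA] at ha ⊢
      refine ⟨hσ1 a ha.1, ?_⟩
      have := hle (σ a)
      rw [hσ2 a ha.1] at this
      omega
    have hinj : Set.InjOn σ A := by
      intro a ha c hc hac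
      have ha := ((hA a).1 ha).1
      have hc := ((hA c).1 hc).1
      rw [← hσ2 a ha, ← hσ2 c hc, hac]
    have himg : A.image σ = A := by
      apply Finset.eq_of_subset_of_card_le
      · intro x hx
        obtain ⟨a, ha, rfl⟩ := Finset.mem_image.1 hx
        exact hmaps a ha
      · rw [Finset.card_image_of_injOn hinj]
    have hs : ∑ a ∈ A, n (σ a) = ∑ a ∈ A, n a := by
      conv_rhs => rw [← himg, Finset.sum_image hinj]
    have heq := (Finset.sum_eq_sum_iff_of_le (fun a ha => by
      have := hle (σ a)
      rwa [hσ2 a ((hA a).1 ha).1] at this)).1 hs j ((hA j).2 ⟨hj, le_rfl⟩)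
    refine ⟨σ j, hσ1 j hj, hσ2 j hj, heq, ?_⟩
    have := hsing (σ j)
    rw [hσ2 j hj] at this
    exact this heq
  have hPf : ∀ i, n i ∉ S → n (f i) ∉ S := by
    intro i hi
    let A := (hAfin (n i)).toFinset
    have hA : ∀ x, x ∈ A ↔ n x ∉ S ∧ n x ≤ n i := by intro i; simp [A]
    choose! σ hσ1 hσ2 hσ3 hσ4 using hP
    have hmaps : ∀ a ∈ A, σ a ∈ A := by
      intro a ha
      rw [hA] at ha ⊢
      exact ⟨hσ1 a ha.1, by rw [hσ3 a ha.1]; exact ha.2⟩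
    have hinj : Set.InjOn σ A := by
      intro a ha c hc hac
      have ha := ((hA a).1 ha).1
      have hc := ((hA c).1 hc).1
      rw [← hσ2 a ha, ← hσ2 c hc, hac]
    obtain ⟨a, ha, hai⟩ := Finset.surj_on_of_inj_on_of_card_le (s := A) (t := A) (fun a _ => σ a)
      hmaps (fun a c ha hc h => hinj ha hc h) le_rfl i ((hA i).2 ⟨hi, le_rfl⟩)
    have ha := ((hA a).1 ha).1
    rw [hai, hσ2 a ha]
    exact ha
  -- elements with values in K
  have hKf : ∀ j, n j ∈ K → ∃ i, F j = {i} ∧ n i = n j := by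
    intro j hj
    have hall : ∀ i ∈ F j, n i ∈ S := by
      intro i hi
      by_contra h
      have := hPf i h
      rw [(hFm _ _).1 hi] at this
      exact this (hKS _ hj)
    obtain ⟨i, hi⟩ := hne j
    have h1 := Finset.add_sum_erase (F j) n hi
    rw [hFs] at h1
    rcases Finset.eq_empty_or_nonempty ((F j).erase i) with he | he
    · have hfi := (hFm _ _).1 hi
      have h3 : n i = n j := by rw [he] at h1; simpa using h1
      refine ⟨i, ?_, h3⟩
      have := hsing i
      rw [hfi] at this
      exact this h3
    · exfalso
      have hr := sum_semi n S _ he fun x hx => hall x (Finset.mem_of_mem_erase hx)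
      have hrpos : 0 < ∑ x ∈ (F j).erase i, n x := Finset.sum_pos (fun x _ => hpos x) he
      have hipos := hpos i
      rcases semi_lt (n j) (hall i hi) with h2 | h2
      · rcases semi_lt (n j) hr with h3 | h3
        · have := add_mem h2 h3
          rw [h1] at this
          exact hind _ hj this
        · omega
      · omega
  have hSd : ∀ m ∈ S, Nat.setGcd K ∣ m := by
    intro m hm
    induction hm using AddSubsemigroup.closure_induction with
    | mem x hx => exact Nat.setGcd_dvd_of_mem hx
    | add x y _ _ hx hy => exact dvd_add hx hy
  have hF0 : {i | n i ∈ S ∧ n i ∉ K}.Finite := by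
    by_cases hKn : K.Nonempty
    · refine Set.Finite.subset
        (s := ⋃ v ∈ {v | v ∈ {m ∈ Set.range n | Nat.setGcd K ∣ m} ∧ v ∉ K}, {i | n i = v}) ?_ ?_
      · exact Set.Finite.biUnion ((hgcd hKn).subset fun v hv => hv.1) fun v hv => hfib v hv.2
      · intro i hi
        simp only [Set.mem_iUnion]
        exact ⟨n i, ⟨⟨⟨i, rfl⟩, hSd _ hi.1⟩, hi.2⟩, rfl⟩
    · rw [Set.not_nonempty_iff_eq_empty] at hKn
      have : {i | n i ∈ S ∧ n i ∉ K} = ∅ := by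
        ext i
        rw [hS, hKn, AddSubsemigroup.closure_empty]
        simp [AddSubsemigroup.notMem_bot]
      rw [this]; exact Set.finite_empty
  let T := hF0.toFinset
  have hT : ∀ i, i ∈ T ↔ n i ∈ S ∧ n i ∉ K := by intro i; simp [T]
  have hTf : ∀ i ∈ T, f i ∈ T := by
    intro i hi
    rw [hT] at hi ⊢
    have hm : i ∈ F (f i) := (hFm _ _).2 rfl
    constructor
    · by_contra h
      obtain ⟨x, hx, _, _, hx2⟩ := hP _ h
      rw [hx2, Finset.mem_singleton] at hm
      exact hx (hm ▸ hi.1)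
    · intro h
      obtain ⟨x, hx, hx2⟩ := hKf _ h
      rw [hx, Finset.mem_singleton] at hm
      subst hm
      exact hi.2 (hx2 ▸ h)
  have hTU : T ⊆ T.biUnion F := by
    intro i hi
    exact Finset.mem_biUnion.2 ⟨f i, hTf i hi, (hFm _ _).2 rfl⟩
  have hTs : ∑ i ∈ T.biUnion F, n i = ∑ i ∈ T, n i := by
    rw [Finset.sum_biUnion]
    · exact Finset.sum_congr rfl fun j _ => hFs j
    · intro a _ c _ hac
      rw [Function.onFun, Finset.disjoint_left]
      intro x hx hx'
      exact hac (((hFm _ _).1 hx).symm.trans ((hFm _ _).1 hx'))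
  have hTback : ∀ i, f i ∈ T → i ∈ T := by
    intro i hi
    by_contra hni
    have := Finset.sum_lt_sum_of_subset (f := n) hTU
      (Finset.mem_biUnion.2 ⟨f i, hi, (hFm _ _).2 rfl⟩) hni (hpos i) (fun _ _ _ => Nat.zero_le _)
    omega
  have hTinj : Set.InjOn f T := by
    apply Finset.injOn_of_surjOn_of_card_le f (t := T) hTf _ le_rfl
    intro j hj
    obtain ⟨i, rfl⟩ := hsurj j
    exact ⟨i, hTback i hj, rfl⟩
  intro a c hac
  have ha : a ∈ F (f a) := (hFm _ _).2 rfl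
  have hc : c ∈ F (f a) := (hFm _ _).2 hac.symm
  by_cases h1 : n (f a) ∈ S
  · by_cases h2 : n (f a) ∈ K
    · obtain ⟨x, hx, _⟩ := hKf _ h2
      rw [hx, Finset.mem_singleton] at ha hc
      rw [ha, hc]
    · have h3 : f a ∈ T := (hT _).2 ⟨h1, h2⟩
      exact hTinj (hTback a h3) (hTback c (hac ▸ h3)) hac
  · obtain ⟨x, _, _, _, hx⟩ := hP _ h1
    rw [hx, Finset.mem_singleton] at ha hc
    rw [ha, hc]

/-- A sequence ⟨n_i : i ∈ I⟩ of positive naturals is reversible iff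
K = {m : {i | n_i = m} is infinite} is independent and, if K is nonempty, then gcd(K)
divides at most finitely many elements of the set of values {n_i : i ∈ I}. -/
theorem stmt4 {I : Type*} (n : I → ℕ) (hpos : ∀ i, 0 < n i) :
    RevSeqNat n ↔
      (IndepSet {m : ℕ | {i | n i = m}.Infinite} ∧
        ({m : ℕ | {i | n i = m}.Infinite}.Nonempty →
          ∀ d : ℕ,
            ((∀ k ∈ {m : ℕ | {i | n i = m}.Infinite}, d ∣ k) ∧
              ∀ e : ℕ, (∀ k ∈ {m : ℕ | {i | n i = m}.Infinite}, e ∣ k) → e ∣ d) →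
            {m ∈ Set.range n | d ∣ m}.Finite)) := by
  constructor
  · intro h
    refine ⟨fwd_indep n hpos h, fun _ d hd => ?_⟩
    have hdd : d = Nat.setGcd (infVals n) :=
      Nat.dvd_antisymm (Nat.dvd_setGcd_iff.2 hd.1)
        (hd.2 _ fun k hk => Nat.setGcd_dvd_of_mem hk)
    rw [hdd]
    exact fwd_gcd n hpos h
  · rintro ⟨h1, h2⟩
    refine bwd n hpos h1 fun hne => h2 hne _ ⟨fun k hk => Nat.setGcd_dvd_of_mem hk,
      fun e he => Nat.dvd_setGcd_iff.2 he⟩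
end

section
/- Let L_i, i ∈ I, be pairwise disjoint σ-scattered linear orders such that the sequence of bi-embedability classes ⟨[L_i]_⇄ : i ∈ I⟩ is finite-to-one (i.e., there is no infinite J ⊆ I with L_i ⇄ L_j for all i, j ∈ J). Then the disjoint union poset ⋃_{i∈I} L_i is reversible. -/
/-- A poset is reversible iff every bijective homomorphism (monotone bijection) of it to
itself is an automorphism (i.e. its inverse is also monotone). -/
def Reversible (P : Type*) [PartialOrder P] : Prop :=
  ∀ f : P → P, Function.Bijective f → Monotone f → ∀ x y : P, f x ≤ f y → x ≤ y

/-- A linear order is scattered iff the rational line does not embed into it. -/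
def Scattered (L : Type*) [LinearOrder L] : Prop := IsEmpty (ℚ ↪o L)

/-- A linear order is σ-scattered iff it is an at most countable union of scattered
suborders. -/
def SigmaScattered (L : Type*) [LinearOrder L] : Prop :=
  ∃ S : ℕ → Set L, (⋃ k, S k) = Set.univ ∧ ∀ k, Scattered ↥(S k)


namespace LV

def In (A X : Set ℕ) : Prop := X ⊆ A ∧ X.Infinite

def agree (n : ℕ) (X Y : Set ℕ) : Prop := ∀ k < n, (k ∈ X ↔ k ∈ Y)

def tl (X : Set ℕ) : Set ℕ := {k | k ∈ X ∧ ∃ j ∈ X, j < k}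

lemma agree_refl (n : ℕ) (X : Set ℕ) : agree n X X := fun _ _ => Iff.rfl
lemma agree.symm {n : ℕ} {X Y : Set ℕ} (h : agree n X Y) : agree n Y X := fun k hk => (h k hk).symm
lemma agree.trans {n : ℕ} {X Y Z : Set ℕ} (h : agree n X Y) (h' : agree n Y Z) : agree n X Z :=
  fun k hk => (h k hk).trans (h' k hk)
lemma agree.mono {n m : ℕ} {X Y : Set ℕ} (h : agree n X Y) (hm : m ≤ n) : agree m X Y :=
  fun k hk => h k (hk.trans_le hm)
lemma agree.tl {n : ℕ} {X Y : Set ℕ} (h : agree n X Y) : agree n (tl X) (tl Y) := by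
  intro k hk
  constructor
  · rintro ⟨h1, j, hj, hjk⟩
    exact ⟨(h k hk).1 h1, j, (h j (hjk.trans hk)).1 hj, hjk⟩
  · rintro ⟨h1, j, hj, hjk⟩
    exact ⟨(h k hk).2 h1, j, (h j (hjk.trans hk)).2 hj, hjk⟩

lemma tl_subset (X : Set ℕ) : tl X ⊆ X := fun _ h => h.1

lemma tl_infinite {X : Set ℕ} (h : X.Infinite) : (tl X).Infinite := by
  obtain ⟨m, hm⟩ := h.nonempty
  have h2 : (X \ Set.Iic m).Infinite := h.sdiff (Set.finite_Iic m)
  refine h2.mono ?_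
  rintro k ⟨hk, hk'⟩
  exact ⟨hk, m, hm, by simpa using hk'⟩

lemma In.tl {A X : Set ℕ} (h : In A X) : In A (tl X) :=
  ⟨(tl_subset X).trans h.1, tl_infinite h.2⟩

lemma In.trans {A B X : Set ℕ} (h : In A B) (h' : In B X) : In A X := ⟨h'.1.trans h.1, h'.2⟩

def Cont {Q : Sort*} (A : Set ℕ) (f : Set ℕ → Q) : Prop :=
  ∀ X, In A X → ∃ n, ∀ Y, In A Y → agree n X Y → f Y = f X

def Bad {Q : Type*} (le : Q → Q → Prop) (A : Set ℕ) (f : Set ℕ → Q) : Prop :=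
  ∀ X, In A X → ¬ le (f X) (f (tl X))

lemma Cont.mono {Q : Sort*} {A B : Set ℕ} {f : Set ℕ → Q} (h : Cont A f) (hB : B ⊆ A) : Cont B f := by
  intro X hX
  obtain ⟨n, hn⟩ := h X ⟨hX.1.trans hB, hX.2⟩
  exact ⟨n, fun Y hY => hn Y ⟨hY.1.trans hB, hY.2⟩⟩

/-- sequence of dependent choices -/
lemma exists_seq {α : Type*} (R : α → α → Prop) (a : α) (h : ∀ x, ∃ y, R x y) :
    ∃ s : ℕ → α, s 0 = a ∧ ∀ n, R (s n) (s (n+1)) := by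
  choose g hg using h
  exact ⟨fun n => Nat.rec a (fun _ x => g x) n, rfl, fun n => hg _⟩

def above (A s : Set ℕ) : Set ℕ := {x | x ∈ A ∧ ∀ y ∈ s, y < x}

def Hom (A : Set ℕ) (U : Set ℕ → Prop) (s : Set ℕ) : Prop :=
  ∀ A', In (above A s) A' → ∃ B, In A' B ∧
    ((∀ X, In B X → U (s ∪ X)) ∨ (∀ X, In B X → ¬ U (s ∪ X)))

lemma eq_insert_tl {X : Set ℕ} {m : ℕ} (hm : m ∈ X) (h : ∀ k ∈ X, m ≤ k) : X = insert m (tl X) := by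
  ext k
  constructor
  · intro hk
    rcases (h k hk).eq_or_lt with h1 | h1
    · left; exact h1.symm
    · right; exact ⟨hk, m, hm, h1⟩
  · rintro (rfl | hk)
    · exact hm
    · exact hk.1

lemma hom_step (A : Set ℕ) (U : Set ℕ → Prop) (s : Set ℕ)
    (h : ∀ a ∈ above A s, Hom A U (insert a s)) : Hom A U s := by
  intro A' hA'
  let St := {p : Set ℕ × ℕ // In A' p.1 ∧ p.2 ∈ p.1}
  obtain ⟨a0, ha0⟩ := hA'.2.nonempty
  obtain ⟨q, -, hq⟩ := exists_seq (α := St)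
    (fun p p' => p'.1.1 ⊆ p.1.1 ∧ (∀ k ∈ p'.1.1, p.1.2 < k) ∧
      ((∀ X, In p'.1.1 X → U (insert p.1.2 s ∪ X)) ∨ (∀ X, In p'.1.1 X → ¬ U (insert p.1.2 s ∪ X))))
    ⟨(A', a0), ⟨⟨subset_rfl, hA'.2⟩, ha0⟩⟩ (by
      rintro ⟨⟨B, a⟩, hB, ha⟩
      have h1 : a ∈ above A s := hA'.1 (hB.1 ha)
      obtain ⟨C, hC, hC'⟩ := h a h1 (B \ Set.Iic a) ⟨by
        rintro k ⟨hk, hk'⟩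
        refine ⟨(hA'.1 (hB.1 hk)).1, ?_⟩
        rintro y (rfl | hy)
        · simpa using hk'
        · exact (hA'.1 (hB.1 hk)).2 y hy, hB.2.sdiff (Set.finite_Iic a)⟩
      obtain ⟨c, hc⟩ := hC.2.nonempty
      refine ⟨⟨(C, c), ⟨⟨fun k hk => hB.1 (hC.1 hk).1, hC.2⟩, hc⟩⟩, fun k hk => (hC.1 hk).1, ?_, hC'⟩
      intro k hk
      have := (hC.1 hk).2
      simpa using this)
  have hsub : ∀ n m, n ≤ m → (q m).1.1 ⊆ (q n).1.1 := by
    intro n m hnm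
    induction m, hnm using Nat.le_induction with
    | base => exact subset_rfl
    | succ m _ ih => exact (hq m).1.trans ih
  have hmono : StrictMono (fun n => (q n).1.2) := by
    refine strictMono_nat_of_lt_succ fun n => ?_
    exact (hq n).2.1 _ (q (n+1)).2.2
  have key : ∀ (D : Set ℕ), D.Infinite → ∀ V : Prop → Prop,
      (∀ n ∈ D, ∀ X, In (q (n+1)).1.1 X → V (U (insert (q n).1.2 s ∪ X))) →
      ∃ B, In A' B ∧ ∀ X, In B X → V (U (s ∪ X)) := by
    intro D hD V hV
    refine ⟨(fun n => (q n).1.2) '' D, ⟨?_, hD.image hmono.injective.injOn⟩, ?_⟩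
    · rintro _ ⟨n, hn, rfl⟩
      exact (q n).2.1.1 (q n).2.2
    · intro X hX
      classical
      obtain ⟨m, hm, hmin⟩ : ∃ m ∈ X, ∀ k ∈ X, m ≤ k :=
        ⟨sInf X, Nat.sInf_mem hX.2.nonempty, fun k hk => Nat.sInf_le hk⟩
      obtain ⟨n, hn, rfl⟩ := hX.1 hm
      have h2 := hV n hn (tl X) ⟨by
        rintro k ⟨hk, j, hj, hjk⟩
        obtain ⟨i, hi, rfl⟩ := hX.1 hk
        have : (q n).1.2 < (q i).1.2 := (hmin j hj).trans_lt hjk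
        have hni : n < i := hmono.lt_iff_lt.1 this
        exact hsub (n+1) i hni (q i).2.2, tl_infinite hX.2⟩
      have h3 : s ∪ X = insert (q n).1.2 s ∪ tl X := by
        conv_lhs => rw [eq_insert_tl hm hmin]
        ext k; simp; tauto
      rwa [h3]
  by_cases hD : {n | ∀ X, In (q (n+1)).1.1 X → U (insert (q n).1.2 s ∪ X)}.Infinite
  · obtain ⟨B, hB, hB'⟩ := key _ hD (fun p => p) (fun n hn => hn)
    exact ⟨B, hB, Or.inl hB'⟩
  · have hD' : {n | ∀ X, In (q (n+1)).1.1 X → U (insert (q n).1.2 s ∪ X)}ᶜ.Infinite :=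
      (Set.not_infinite.1 hD).infinite_compl
    obtain ⟨B, hB, hB'⟩ := key _ hD' (fun p => ¬ p) (fun n hn => by
      rcases (hq n).2.2 with h | h
      · exact absurd h hn
      · exact h)
    exact ⟨B, hB, Or.inr hB'⟩

theorem ramsey {A : Set ℕ} (hA : A.Infinite) (U : Set ℕ → Prop) (hU : Cont A U) :
    ∃ B, In A B ∧ ((∀ X, In B X → U X) ∨ (∀ X, In B X → ¬ U X)) := by
  suffices h : Hom A U ∅ by
    obtain ⟨B, hB, h⟩ := h A ⟨by intro k hk; exact ⟨hk, by simp⟩, hA⟩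
    refine ⟨B, hB, ?_⟩
    simpa using h
  by_contra hcon
  let St := {s : Set ℕ // ¬ Hom A U s ∧ s ⊆ A}
  obtain ⟨q, h0, hq⟩ := exists_seq (α := St)
    (fun s s' => ∃ a ∈ above A s.1, s'.1 = insert a s.1) ⟨∅, hcon, by simp⟩ (by
      rintro ⟨s, hs, hsA⟩
      by_contra hne
      apply hs
      apply hom_step
      intro a ha
      by_contra hh
      exact hne ⟨⟨insert a s, hh, Set.insert_subset ha.1 hsA⟩, a, ha, rfl⟩)
  choose a ha hqa using hq
  have hmemq : ∀ n, ∀ x, x ∈ (q n).1 ↔ ∃ i < n, a i = x := by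
    intro n
    induction n with
    | zero => intro x; rw [h0]; simp
    | succ n ih =>
      intro x
      rw [hqa n]
      simp only [Set.mem_insert_iff, ih x]
      constructor
      · rintro (rfl | ⟨i, hi, h⟩)
        · exact ⟨n, by omega, rfl⟩
        · exact ⟨i, by omega, h⟩
      · rintro ⟨i, hi, h⟩
        rcases Nat.lt_succ_iff_lt_or_eq.1 hi with h' | rfl
        · exact Or.inr ⟨i, h', h⟩
        · exact Or.inl h.symm
  have hmono : StrictMono a := by
    refine strictMono_nat_of_lt_succ fun n => ?_
    exact (ha (n+1)).2 _ ((hmemq _ _).2 ⟨n, by omega, rfl⟩)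
  have hX : In A (Set.range a) := ⟨by rintro _ ⟨n, rfl⟩; exact (ha n).1,
    Set.infinite_range_of_injective hmono.injective⟩
  obtain ⟨n, hn⟩ := hU _ hX
  apply (q (n+1)).2.1
  intro A' hA'
  refine ⟨A', ⟨subset_rfl, hA'.2⟩, ?_⟩
  have hc : ∀ X, In A' X → U ((q (n+1)).1 ∪ X) = U (Set.range a) := by
    intro X hX'
    apply hn
    · refine ⟨Set.union_subset (q (n+1)).2.2 (hX'.1.trans (hA'.1.trans fun k hk => hk.1)), ?_⟩
      exact hX'.2.mono Set.subset_union_right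
    · intro k hk
      constructor
      · rintro ⟨i, rfl⟩
        left
        exact (hmemq _ _).2 ⟨i, by have := hmono.le_apply (x := i); omega, rfl⟩
      · rintro (h | h)
        · obtain ⟨i, _, h⟩ := (hmemq _ _).1 h
          exact ⟨i, h⟩
        · exfalso
          have h1 := (hA'.1 (hX'.1 h)).2 (a n) ((hmemq _ _).2 ⟨n, by omega, rfl⟩)
          have := hmono.le_apply (x := n); omega
  by_cases hh : U (Set.range a)
  · left; intro X hX'; rw [hc X hX']; exact hh
  · right; intro X hX'; rw [hc X hX']; exact hh

end LV

namespace LV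

structure Arr (Q : Type*) where
  A : Set ℕ
  N : Set ℕ → ℕ
  f : Set ℕ → Q
  inf : A.Infinite
  cell : ∀ X Y, In A X → In A Y → agree (N X) X Y → N Y = N X ∧ f Y = f X

section
variable {Q : Type*} (lt : Q → Q → Prop)

def Sub (τ σ : Arr Q) : Prop := τ.A ⊆ σ.A ∧ ∀ X, In τ.A X →
  (τ.N X = σ.N X ∧ τ.f X = σ.f X) ∨
  (∀ Y, In τ.A Y → agree (σ.N X) X Y → σ.N X ≤ τ.N Y ∧ lt (τ.f Y) (σ.f Y))

variable {lt}

lemma Sub.rfl' (σ : Arr Q) : Sub lt σ σ := ⟨subset_rfl, fun _ _ => Or.inl ⟨rfl, rfl⟩⟩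

lemma In.mono {A B X : Set ℕ} (h : In A X) (hB : A ⊆ B) : In B X := ⟨h.1.trans hB, h.2⟩

lemma Sub.dich {τ σ : Arr Q} (h : Sub lt τ σ) {X : Set ℕ} (hX : In τ.A X) :
    (τ.N X = σ.N X ∧ τ.f X = σ.f X) ∨ (σ.N X ≤ τ.N X ∧ lt (τ.f X) (σ.f X)) :=
  (h.2 X hX).imp id fun h => h X hX (agree_refl _ _)

lemma Sub.N_le {τ σ : Arr Q} (h : Sub lt τ σ) {X : Set ℕ} (hX : In τ.A X) : σ.N X ≤ τ.N X := by
  rcases h.dich hX with h | h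
  · exact h.1.ge
  · exact h.1

lemma Sub.trans [IsTrans Q lt] {ρ τ σ : Arr Q} (h1 : Sub lt ρ τ) (h2 : Sub lt τ σ) : Sub lt ρ σ := by
  refine ⟨h1.1.trans h2.1, fun X hX => ?_⟩
  rcases h2.2 X (hX.mono h1.1) with h | h
  · rcases h1.2 X hX with h' | h'
    · exact Or.inl ⟨h'.1.trans h.1, h'.2.trans h.2⟩
    · right
      intro Y hY hag
      rw [← h.1] at hag
      have := h' Y hY hag
      rw [h.1] at this
      refine ⟨this.1, ?_⟩
      rw [h.1] at hag
      have e1 := (σ.cell X Y (hX.mono (h1.1.trans h2.1)) (hY.mono (h1.1.trans h2.1)) hag).2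
      rw [← h.1] at hag
      have e2 := (τ.cell X Y (hX.mono h1.1) (hY.mono h1.1) hag).2
      rw [e1, ← h.2, ← e2]
      exact this.2
  · right
    intro Y hY hag
    have := h Y (hY.mono h1.1) hag
    rcases h1.dich hY with h' | h'
    · rw [h'.1, h'.2]; exact this
    · exact ⟨this.1.trans h'.1, _root_.trans h'.2 this.2⟩

def SubB (lt : Q → Q → Prop) (b : ℕ) (τ σ : Arr Q) : Prop := Sub lt τ σ ∧ agree b τ.A σ.A

lemma SubB.trans [IsTrans Q lt] {b : ℕ} {ρ τ σ : Arr Q} (h1 : SubB lt b ρ τ) (h2 : SubB lt b τ σ) :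
    SubB lt b ρ σ := ⟨h1.1.trans h2.1, h1.2.trans h2.2⟩

def ABad (le : Q → Q → Prop) (σ : Arr Q) : Prop := Bad le σ.A σ.f

def Decided (σ : Arr Q) (b : ℕ) (s : Set ℕ) (q : Q) : Prop :=
  ∀ X Y, In σ.A X → In σ.A Y → agree b s X → agree b s Y → agree (σ.N X) X Y ∧ σ.f X = q

def Final (lt le : Q → Q → Prop) (b : ℕ) (s : Set ℕ) (σ : Arr Q) : Prop :=
  (∀ τ, SubB lt b τ σ → ABad le τ → ∀ q, ¬ Decided τ b s q) ∨
  (∃ q, Decided σ b s q ∧ ∀ ρ, SubB lt b ρ σ → ABad le ρ → (∃ X, In ρ.A X ∧ agree b s X) →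
    ¬ ∀ X, In ρ.A X → agree b s X → lt (ρ.f X) q)

lemma Final.mono [IsTrans Q lt] {le : Q → Q → Prop} {b : ℕ} {s : Set ℕ} {τ σ : Arr Q}
    (h : Final lt le b s σ) (hs : SubB lt b τ σ) (hb : ABad le τ) : Final lt le b s τ := by
  rcases h with h | ⟨q, hq, h⟩
  · left
    exact fun ρ hρ hb' => h ρ (hρ.trans hs) hb'
  · right
    refine ⟨q, ?_, fun ρ hρ hb' => h ρ (hρ.trans hs) hb'⟩
    intro X Y hX hY aX aY
    rcases hs.1.2 X hX with h1 | h1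
    · obtain ⟨h2, h3⟩ := hq X Y (hX.mono hs.1.1) (hY.mono hs.1.1) aX aY
      rw [h1.1, h1.2]
      exact ⟨h2, h3⟩
    · exfalso
      refine h τ hs hb ⟨X, hX, aX⟩ ?_
      intro Z hZ aZ
      have h2 := hq X Z (hX.mono hs.1.1) (hZ.mono hs.1.1) aX aZ
      have h3 := hq Z Z (hZ.mono hs.1.1) (hZ.mono hs.1.1) aZ aZ
      rw [← h3.2]
      exact (h1 Z hZ h2.1).2

lemma exists_final [IsTrans Q lt] (wf : WellFounded lt) {le : Q → Q → Prop} (b : ℕ) (s : Set ℕ)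
    (σ : Arr Q) (hσ : ABad le σ) : ∃ τ, SubB lt b τ σ ∧ ABad le τ ∧ Final lt le b s τ := by
  by_cases h : ∃ σ', SubB lt b σ' σ ∧ ABad le σ' ∧
      ∀ τ, SubB lt b τ σ' → ABad le τ → ∀ q, ¬ Decided τ b s q
  · obtain ⟨σ', h1, h2, h3⟩ := h
    exact ⟨σ', h1, h2, Or.inl h3⟩
  · push Not at h
    let V : Set Q := {q | ∃ τ, SubB lt b τ σ ∧ ABad le τ ∧ Decided τ b s q}
    have hV : V.Nonempty := by
      obtain ⟨τ, h1, h2, q, h3⟩ := h σ ⟨Sub.rfl' σ, agree_refl _ _⟩ hσ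
      exact ⟨q, τ, h1, h2, h3⟩
    obtain ⟨τ, h1, h2, h3⟩ := wf.min_mem V hV
    refine ⟨τ, h1, h2, Or.inr ⟨_, h3, ?_⟩⟩
    rintro ρ hρ hρb ⟨X, hX, aX⟩ hall
    obtain ⟨π, p1, p2, q', p3⟩ := h ρ (hρ.trans h1) hρb
    let X' : Set ℕ := {k | k ∈ π.A ∧ (k < b → k ∈ X)}
    have hX'π : In π.A X' := by
      refine ⟨fun k hk => hk.1, ?_⟩
      refine (π.inf.sdiff (Set.finite_Iio b)).mono ?_
      rintro k ⟨hk, hk'⟩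
      exact ⟨hk, fun h => absurd h hk'⟩
    have aX' : agree b s X' := by
      refine aX.trans ?_
      intro k hk
      constructor
      · intro h
        exact ⟨(p1.2 k hk).2 (hX.1 h), fun _ => h⟩
      · intro h; exact h.2 hk
    have l1 := hall X' (hX'π.mono p1.1.1) aX'
    have l2 := (p3 X' X' hX'π hX'π aX' aX').2
    have l3 : lt q' (wf.min V hV) := by
      rw [← l2]
      rcases p1.1.dich hX'π with h | h
      · rw [h.2]; exact l1
      · exact _root_.trans h.2 l1
    exact wf.not_lt_min V ⟨π, p1.trans (hρ.trans h1), p2, p3⟩ l3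

lemma exists_final_all [IsTrans Q lt] (wf : WellFounded lt) {le : Q → Q → Prop} (b : ℕ)
    (σ : Arr Q) (hσ : ABad le σ) : ∃ τ, SubB lt b τ σ ∧ ABad le τ ∧
      ∀ s : Set ℕ, Final lt le b s τ := by
  have h : ∀ F : Finset (Finset ℕ), ∃ τ, SubB lt b τ σ ∧ ABad le τ ∧
      ∀ s ∈ F, Final lt le b (s : Set ℕ) τ := by
    intro F
    classical
    induction F using Finset.induction_on with
    | empty => exact ⟨σ, ⟨Sub.rfl' σ, agree_refl _ _⟩, hσ, by simp⟩
    | insert s F _ ih =>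
      obtain ⟨τ, h1, h2, h3⟩ := ih
      obtain ⟨ρ, r1, r2, r3⟩ := exists_final (lt := lt) wf b (s : Set ℕ) τ h2
      refine ⟨ρ, r1.trans h1, r2, ?_⟩
      intro t ht
      rcases Finset.mem_insert.1 ht with rfl | ht
      · exact r3
      · exact (h3 t ht).mono r1 r2
  obtain ⟨τ, h1, h2, h3⟩ := h (Finset.range b).powerset
  refine ⟨τ, h1, h2, fun s => ?_⟩
  classical
  let t : Finset ℕ := (Finset.range b).filter (· ∈ s)
  have ht : agree b (t : Set ℕ) s := by
    intro k hk; simp [t, hk]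
  have := h3 t (Finset.mem_powerset.2 (Finset.filter_subset _ _))
  have e : ∀ X, agree b (t : Set ℕ) X ↔ agree b s X :=
    fun X => ⟨fun h => ht.symm.trans h, fun h => ht.trans h⟩
  simpa only [Final, Decided, e] using this

theorem min_bad [IsTrans Q lt] (wf : WellFounded lt) {le : Q → Q → Prop}
    (hle : ∀ p q r, lt q r → ¬ le p r → ¬ le p q) (σ0 : Arr Q) (hσ0 : ABad le σ0) :
    ∃ σ : Arr Q, ABad le σ ∧ ∀ B h, In σ.A B → Cont B h → Bad le B h →
      ¬ ∀ X, In B X → lt (h X) (σ.f X) := by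
  have irr : ∀ q, ¬ lt q q := fun q hq => wf.irrefl.irrefl q hq
  obtain ⟨q, hq0, hq⟩ := exists_seq (α := {σ : Arr Q // ABad le σ} × ℕ)
    (fun p p' => SubB lt p.2 p'.1.1 p.1.1 ∧ (∀ s, Final lt le p.2 s p'.1.1) ∧
      ∃ c, p'.2 = c + 1 ∧ c ∈ p'.1.1.A ∧ p.2 ≤ c ∧ ∀ k ∈ p'.1.1.A, p.2 ≤ k → c ≤ k)
    (⟨σ0, hσ0⟩, 0) (by
      rintro ⟨⟨σ, hσ⟩, b⟩
      obtain ⟨τ, h1, h2, h3⟩ := exists_final_all (lt := lt) wf b σ hσ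
      have hne : {k | k ∈ τ.A ∧ b ≤ k}.Nonempty := by
        obtain ⟨k, hk, hk'⟩ := (τ.inf.sdiff (Set.finite_Iio b)).nonempty
        exact ⟨k, hk, by simpa using hk'⟩
      have hm := Nat.sInf_mem hne
      refine ⟨(⟨τ, h2⟩, sInf {k | k ∈ τ.A ∧ b ≤ k} + 1), h1, h3, _, rfl, hm.1, hm.2, ?_⟩
      intro k hk hbk
      exact Nat.sInf_le ⟨hk, hbk⟩)
  let σ : ℕ → Arr Q := fun n => (q n).1.1
  let b : ℕ → ℕ := fun n => (q n).2
  have hσ : ∀ n, ABad le (σ n) := fun n => (q n).1.2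
  have hsub1 : ∀ n, SubB lt (b n) (σ (n+1)) (σ n) := fun n => (hq n).1
  have hfin : ∀ n s, Final lt le (b n) s (σ (n+1)) := fun n => (hq n).2.1
  choose c hc1 hc2 hc3 hc4 using fun n => (hq n).2.2
  have hbmono : StrictMono b := strictMono_nat_of_lt_succ fun n => by
    have := hc1 n; have := hc3 n; simp only [b]; omega
  have hsub : ∀ n m, n ≤ m → SubB lt (b n) (σ m) (σ n) := by
    intro n m hnm
    induction m, hnm using Nat.le_induction with
    | base => exact ⟨Sub.rfl' _, agree_refl _ _⟩
    | succ m hnm ih =>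
      exact SubB.trans ⟨(hsub1 m).1, (hsub1 m).2.mono (hbmono.monotone hnm)⟩ ih
  let A : Set ℕ := ⋂ n, (σ n).A
  have hAsub : ∀ n, A ⊆ (σ n).A := fun n => Set.iInter_subset _ n
  have hAagree : ∀ n, agree (b n) A (σ n).A := by
    intro n k hk
    refine ⟨fun h => hAsub n h, fun h => ?_⟩
    refine Set.mem_iInter.2 fun m => ?_
    rcases le_total n m with hnm | hnm
    · exact ((hsub n m hnm).2 k hk).2 h
    · exact (hsub m n hnm).1.1 h
  have hcA : ∀ n, c n ∈ A := fun n => (hAagree (n+1) (c n) (by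
    have := hc1 n; simp only [b]; omega)).2 (hc2 n)
  have hcmono : StrictMono c := strictMono_nat_of_lt_succ fun n => by
    have := hc1 n; have := hc3 (n+1); omega
  have hAinf : A.Infinite :=
    (Set.infinite_range_of_injective hcmono.injective).mono (by rintro _ ⟨n, rfl⟩; exact hcA n)
  have hstab : ∀ X, ∃ n, In A X → ∀ m, n ≤ m →
      (σ m).N X = (σ n).N X ∧ (σ m).f X = (σ n).f X := by
    intro X
    by_cases hX : In A X
    · let V : Set Q := Set.range fun n => (σ n).f X
      have hV : V.Nonempty := ⟨_, 0, rfl⟩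
      obtain ⟨n, hn⟩ := wf.min_mem V hV
      refine ⟨n, fun _ m hnm => ?_⟩
      rcases (hsub n m hnm).1.dich (hX.mono (hAsub m)) with h | h
      · exact h
      · exfalso
        have h2 := h.2
        rw [show (σ n).f X = wf.min V hV from hn] at h2
        exact wf.not_lt_min V ⟨m, rfl⟩ h2
    · exact ⟨0, fun h => absurd h hX⟩
  choose st hst using hstab
  have hcell : ∀ X Y, In A X → In A Y → agree ((σ (st X)).N X) X Y →
      ∀ m, st X ≤ m → (σ m).N Y = (σ (st X)).N X ∧ (σ m).f Y = (σ (st X)).f X := by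
    intro X Y hX hY hag m hm
    obtain ⟨e1, e2⟩ := hst X hX m hm
    rw [← e1] at hag
    have := (σ m).cell X Y (hX.mono (hAsub m)) (hY.mono (hAsub m)) hag
    rw [this.1, this.2]
    exact ⟨e1, e2⟩
  let ω : Arr Q := 
    { A := A
      N := fun X => (σ (st X)).N X
      f := fun X => (σ (st X)).f X
      inf := hAinf
      cell := by
        intro X Y hX hY hag
        have h1 := hcell X Y hX hY hag (max (st X) (st Y)) (le_max_left _ _)
        have h2 := hst Y hY (max (st X) (st Y)) (le_max_right _ _)
        exact ⟨h2.1.symm.trans h1.1, h2.2.symm.trans h1.2⟩ }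
  have hωev : ∀ X, In A X → ∀ m, st X ≤ m → ω.N X = (σ m).N X ∧ ω.f X = (σ m).f X :=
    fun X hX m hm => ⟨(hst X hX m hm).1.symm, (hst X hX m hm).2.symm⟩
  have hωsub : ∀ n, Sub lt ω (σ n) := by
    intro n
    refine ⟨hAsub n, fun X hX => ?_⟩
    obtain ⟨e1, e2⟩ := hωev X hX (max n (st X)) (le_max_right _ _)
    rcases (hsub n (max n (st X)) (le_max_left _ _)).1.2 X (hX.mono (hAsub _)) with h | h
    · left; rw [e1, e2]; exact h
    · right
      intro Y hY hag
      have h1 := h Y (hY.mono (hAsub _)) hag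
      obtain ⟨y1, y2⟩ := hωev Y hY (max (max n (st X)) (st Y)) (le_max_right _ _)
      rw [y1, y2]
      rcases (hsub (max n (st X)) (max (max n (st X)) (st Y)) (le_max_left _ _)).1.dich
        (hY.mono (hAsub _)) with h' | h'
      · rw [h'.1, h'.2]; exact h1
      · exact ⟨h1.1.trans h'.1, _root_.trans h'.2 h1.2⟩
  have hωbad : ABad le ω := by
    intro X hX
    have h1 := (hωev X hX (max (st X) (st (tl X))) (le_max_left _ _)).2
    have h2 := (hωev (tl X) hX.tl (max (st X) (st (tl X))) (le_max_right _ _)).2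
    rw [h1, h2]
    exact hσ _ X (hX.mono (hAsub _))
  refine ⟨ω, hωbad, ?_⟩
  intro B h hB hcont hbad hlt
  let V : Set ℕ := {v | ∃ X, In B X ∧ ω.N X = v}
  have hVne : V.Nonempty := ⟨_, B, ⟨subset_rfl, hB.2⟩, rfl⟩
  obtain ⟨X0, hX0, hv⟩ := Nat.sInf_mem hVne
  set v := sInf V with hvdef
  have hvmin : ∀ X, In B X → v ≤ ω.N X := fun X hX => Nat.sInf_le ⟨X, hX, rfl⟩
  have hb0 : b 0 = 0 := by simp only [b, hq0]
  obtain ⟨n, hn1, hn2⟩ : ∃ n, b n ≤ v ∧ v < b (n+1) := by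
    have hex : ∃ n, v < b n := ⟨v+1, by have := hbmono.le_apply (x := v+1); omega⟩
    classical
    have h1 := Nat.find_spec hex
    have h2 : Nat.find hex ≠ 0 := by
      intro h; rw [h, hb0] at h1; omega
    obtain ⟨k, hk⟩ := Nat.exists_eq_succ_of_ne_zero h2
    refine ⟨k, ?_, by rw [hk] at h1; exact h1⟩
    have := Nat.find_min hex (m := k) (by omega)
    omega
  have hvc : v ≤ c n := by have := hc1 n; simp only [b] at hn2; omega
  let S : Set ℕ → Set ℕ := fun X => {m | ω.N X ≤ m ∧ ∀ Y, In B Y → agree m X Y → h Y = h X}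
  have hSne : ∀ X, In B X → (S X).Nonempty := by
    intro X hX
    obtain ⟨m, hm⟩ := hcont X hX
    exact ⟨max m (ω.N X), le_max_right _ _, fun Y hY hag => hm Y hY (hag.mono (le_max_left _ _))⟩
  let Nh : Set ℕ → ℕ := fun X => sInf (S X)
  have hNh : ∀ X, In B X → Nh X ∈ S X := fun X hX => Nat.sInf_mem (hSne X hX)
  have hNhcell : ∀ X Y, In B X → In B Y → agree (Nh X) X Y → Nh Y = Nh X ∧ h Y = h X := by
    intro X Y hX hY hag
    have hx := hNh X hX
    have e1 := hx.2 Y hY hag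
    have e2 := (ω.cell X Y (hB.trans hX) (hB.trans hY) (hag.mono hx.1)).1
    have l1 : Nh Y ≤ Nh X := Nat.sInf_le ⟨by rw [e2]; exact hx.1, fun Z hZ hZa => by
      rw [hx.2 Z hZ (hag.trans hZa), e1]⟩
    have hy := hNh Y hY
    have l2 : Nh X ≤ Nh Y := Nat.sInf_le ⟨by rw [← e2]; exact hy.1, fun Z hZ hZa => by
      rw [hy.2 Z hZ ((hag.mono l1).symm.trans hZa), e1]⟩
    exact ⟨le_antisymm l1 l2, e1⟩
  let C : Set ℕ := {k | k ∈ A ∧ (b n ≤ k → k ∈ B)}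
  have hCA : C ⊆ A := fun k hk => hk.1
  have hBC : B ⊆ C := fun k hk => ⟨hB.1 hk, fun _ => hk⟩
  have hCinf : C.Infinite := hB.2.mono hBC
  have hCB : ∀ X Y, X ⊆ B → Y ⊆ C → agree (b n) X Y → Y ⊆ B := by
    intro X Y hX hY hag k hk
    by_cases hkb : k < b n
    · exact hX ((hag k hkb).2 hk)
    · exact (hY hk).2 (by omega)
  classical
  let G : Arr Q :=
    { A := C
      N := fun X => if X ⊆ B then Nh X else ω.N X
      f := fun X => if X ⊆ B then h X else ω.f X
      inf := hCinf
      cell := by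
        intro X Y hX hY hag
        by_cases hXB : X ⊆ B
        · simp only [if_pos hXB] at hag ⊢
          have hx : In B X := ⟨hXB, hX.2⟩
          have hYB : Y ⊆ B := hCB X Y hXB hY.1
            (hag.mono (hn1.trans ((hvmin X hx).trans (hNh X hx).1)))
          simp only [if_pos hYB]
          exact hNhcell X Y hx ⟨hYB, hY.2⟩ hag
        · simp only [if_neg hXB] at hag ⊢
          have e := ω.cell X Y (hX.mono hCA) (hY.mono hCA) hag
          have hYB : ¬ Y ⊆ B := by
            intro hYB
            apply hXB
            refine hCB Y X hYB hX.1 (hag.symm.mono ?_)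
            rw [← e.1]
            exact hn1.trans (hvmin Y ⟨hYB, hY.2⟩)
          simp only [if_neg hYB]
          exact e }
  have hGsub : Sub lt G ω := by
    refine ⟨hCA, fun X hX => ?_⟩
    by_cases hXB : X ⊆ B
    · right
      intro Y hY hag
      have hYB : Y ⊆ B := hCB X Y hXB hY.1 (hag.mono (hn1.trans (hvmin X ⟨hXB, hX.2⟩)))
      simp only [G, if_pos hYB]
      have e := (ω.cell X Y (hX.mono hCA) (hY.mono hCA) hag).1
      refine ⟨?_, hlt Y ⟨hYB, hY.2⟩⟩
      rw [← e]
      exact (hNh Y ⟨hYB, hY.2⟩).1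
    · left
      simp only [G, if_neg hXB, and_self]
  have hGbad : ABad le G := by
    intro X hX
    simp only [G]
    by_cases hXB : X ⊆ B
    · rw [if_pos hXB, if_pos ((tl_subset X).trans hXB)]
      exact hbad X ⟨hXB, hX.2⟩
    · rw [if_neg hXB]
      have h1 := hωbad X (hX.mono hCA)
      by_cases hT : tl X ⊆ B
      · rw [if_pos hT]
        exact hle _ _ _ (hlt (tl X) ⟨hT, tl_infinite hX.2⟩) h1
      · rw [if_neg hT]
        exact h1
  have hGB : SubB lt (b n) G (σ (n+1)) := by
    refine ⟨hGsub.trans (hωsub (n+1)), ?_⟩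
    have h1 : agree (b n) G.A A := fun k hk =>
      ⟨fun h => hCA h, fun h => ⟨h, fun h' => absurd hk (by omega)⟩⟩
    exact h1.trans ((hAagree (n+1)).mono (hbmono.monotone (Nat.le_succ n)))
  have hX0A : In A X0 := hB.trans hX0
  have hdec : Decided (σ (n+1)) (b n) X0 ((σ (n+1)).f X0) := by
    have h1 : ∀ X, In (σ (n+1)).A X → agree (b n) X0 X → agree (c n) X0 X := by
      intro X hX hag k hk
      by_cases hkb : k < b n
      · exact hag k hkb
      · constructor
        · intro hk'
          have := hc4 n k (hAsub (n+1) (hX0A.1 hk')) (by simp only [b] at hkb; omega)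
          omega
        · intro hk'
          have := hc4 n k (hX.1 hk') (by simp only [b] at hkb; omega)
          omega
    have h2 : (σ (n+1)).N X0 ≤ c n := by
      have := (hωsub (n+1)).N_le hX0A
      omega
    intro X Y hX hY aX aY
    have e := (σ (n+1)).cell X0 X (hX0A.mono (hAsub _)) hX ((h1 X hX aX).mono h2)
    refine ⟨?_, e.2⟩
    rw [e.1]
    exact ((h1 X hX aX).symm.trans (h1 Y hY aY)).mono h2
  have hX0C : In C X0 := hX0.mono hBC
  rcases hfin n X0 with hf | ⟨q', hq', hf⟩
  · exact hf (σ (n+1)) ⟨Sub.rfl' _, agree_refl _ _⟩ (hσ _) _ hdec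
  · refine hf G hGB hGbad ⟨X0, hX0C, agree_refl _ _⟩ ?_
    intro X hX aX
    have hXB : X ⊆ B := hCB X0 X hX0.1 hX.1 aX
    have hXA : In A X := hX.mono hCA
    have e := (hq' X X (hXA.mono (hAsub _)) (hXA.mono (hAsub _)) aX aX).2
    simp only [G, if_pos hXB]
    have l := hlt X ⟨hXB, hX.2⟩
    rcases (hωsub (n+1)).dich hXA with h' | h'
    · rw [← e, ← h'.2]; exact l
    · rw [← e]; exact _root_.trans l h'.2

end
end LV

namespace LV
universe u

inductive Kind | one | sp | sm | sh

inductive Code : Type (u+1)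
  | node (k : Kind) (a b : Ordinal.{u}) (ι : Type u) (c : ι → Code) : Code

namespace Code
def kind : Code.{u} → Kind | node k _ _ _ _ => k
def a : Code.{u} → Ordinal.{u} | node _ a _ _ _ => a
def b : Code.{u} → Ordinal.{u} | node _ _ b _ _ => b
def ι : Code.{u} → Type u | node _ _ _ ι _ => ι
def child : (t : Code.{u}) → t.ι → Code.{u} | node _ _ _ _ c => c

/-- `ge t s` : `s` is below `t`. -/
def ge : Code.{u} → Code.{u} → Prop
  | node k a b _ c => fun s => (∃ j, ge (c j) s) ∨
      (s.kind = k ∧ s.a ≤ a ∧ s.b ≤ b ∧ ∀ i : s.ι, ∃ j, ge (c j) (s.child i))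

def le (s t : Code.{u}) : Prop := ge t s

lemma le_iff (s t : Code.{u}) : le s t ↔ (∃ j, le s (t.child j)) ∨
    (s.kind = t.kind ∧ s.a ≤ t.a ∧ s.b ≤ t.b ∧ ∀ i : s.ι, ∃ j, le (s.child i) (t.child j)) := by
  cases t; rfl

lemma le_rfl (s : Code.{u}) : le s s := by
  induction s with
  | node k a b ι c ih =>
    rw [le_iff]; right
    exact ⟨rfl, _root_.le_rfl, _root_.le_rfl, fun i => ⟨i, ih i⟩⟩

lemma le_trans {s t v : Code.{u}} (h1 : le s t) (h2 : le t v) : le s v := by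
  induction v generalizing s t with
  | node k a b ι c ih =>
    rw [le_iff] at h2 ⊢
    rcases h2 with ⟨j, hj⟩ | ⟨e1, e2, e3, e4⟩
    · exact Or.inl ⟨j, ih j h1 hj⟩
    · rw [le_iff] at h1
      rcases h1 with ⟨j, hj⟩ | ⟨f1, f2, f3, f4⟩
      · obtain ⟨j', hj'⟩ := e4 j
        exact Or.inl ⟨j', ih j' hj hj'⟩
      · refine Or.inr ⟨f1.trans e1, f2.trans e2, f3.trans e3, fun i => ?_⟩
        obtain ⟨j, hj⟩ := f4 i
        obtain ⟨j', hj'⟩ := e4 j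
        exact ⟨j', ih j' hj hj'⟩

lemma child_le (t : Code.{u}) (j : t.ι) : le (t.child j) t := by
  rw [le_iff]; exact Or.inl ⟨j, le_rfl _⟩

def isChild (s t : Code.{u}) : Prop := ∃ j, s = t.child j

lemma isChild_wf : WellFounded isChild.{u} := by
  constructor
  intro t
  induction t with
  | node k a b ι c ih =>
    constructor
    rintro s ⟨j, rfl⟩
    exact ih j

def lt : Code.{u} → Code.{u} → Prop := Relation.TransGen isChild

lemma lt_wf : WellFounded lt.{u} := isChild_wf.transGen

instance : IsTrans Code.{u} lt := ⟨fun _ _ _ => Relation.TransGen.trans⟩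

lemma lt_le {s t : Code.{u}} (h : lt s t) : le s t := by
  induction h with
  | single h => obtain ⟨j, rfl⟩ := h; exact child_le _ _
  | tail _ h ih => obtain ⟨j, rfl⟩ := h; exact le_trans ih (child_le _ _)
end Code
open Code

/-- along tails, an ordinal valued function cannot always decrease -/
lemma no_desc {A : Set ℕ} (hA : A.Infinite) (g : Set ℕ → Ordinal.{u}) :
    ¬ ∀ X, In A X → ¬ g X ≤ g (tl X) := by
  intro h
  have key : ∀ o : Ordinal.{u}, ∀ X, In A X → g X = o → False := by
    intro o
    induction o using WellFoundedLT.induction with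
    | ind o ih =>
      intro X hX e
      exact ih _ (e ▸ not_le.1 (h X hX)) (tl X) hX.tl rfl
  exact key _ A ⟨subset_rfl, hA⟩ rfl

lemma Cont.comp {Q R : Type*} {A : Set ℕ} {f : Set ℕ → Q} (h : Cont A f) (g : Q → R) :
    Cont A (fun X => g (f X)) := by
  intro X hX
  obtain ⟨n, hn⟩ := h X hX
  exact ⟨n, fun Y hY ha => congrArg g (hn Y hY ha)⟩

lemma Cont.comp2 {Q : Type*} {R : Sort*} {A : Set ℕ} {f : Set ℕ → Q} (h : Cont A f) (g : Q → Q → R) :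
    Cont A (fun X => g (f X) (f (tl X))) := by
  intro X hX
  obtain ⟨n, hn⟩ := h X hX
  obtain ⟨m, hm⟩ := h (tl X) hX.tl
  refine ⟨max n m, fun Y hY ha => ?_⟩
  have e1 := hn Y hY (ha.mono (le_max_left _ _))
  have e2 := hm (tl Y) hY.tl ((ha.mono (le_max_right _ _)).tl)
  simp only [e1, e2]

lemma no_bad (σ0 : Arr Code.{u}) : ¬ ABad le σ0 := by
  intro h0
  obtain ⟨σ, hb, hmin⟩ := min_bad (lt := lt) lt_wf (le := le)
    (fun p q r h1 h2 h3 => h2 (le_trans h3 (lt_le h1))) σ0 h0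
  have hc : Cont σ.A σ.f := fun X hX => ⟨σ.N X, fun Y hY ha => (σ.cell X Y hX hY ha).2⟩
  have step : ∀ (A : Set ℕ), In σ.A A → ∀ R : Code.{u} → Code.{u} → Prop,
      (∀ B, In σ.A B → ¬ ∀ X, In B X → ¬ R (σ.f X) (σ.f (tl X))) →
      ∃ B, In A B ∧ ∀ X, In B X → R (σ.f X) (σ.f (tl X)) := by
    intro A hA R hR
    obtain ⟨B, hB, h | h⟩ := ramsey hA.2 (fun X => R (σ.f X) (σ.f (tl X)))
      ((hc.comp2 R).mono hA.1)
    · exact ⟨B, hB, h⟩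
    · exact absurd h (hR B (hA.trans hB))
  obtain ⟨A1, hA1, h1⟩ := step σ.A ⟨subset_rfl, σ.inf⟩ (fun s t => s.a ≤ t.a)
    (fun B hB => no_desc hB.2 (fun X => (σ.f X).a))
  obtain ⟨A2, hA2, h2⟩ := step A1 hA1 (fun s t => s.b ≤ t.b)
    (fun B hB => no_desc hB.2 (fun X => (σ.f X).b))
  have hA2' := hA1.trans hA2
  obtain ⟨A3, hA3, h3⟩ := step A2 hA2' (fun s t => s.kind = t.kind) (by
    intro B hB hall
    have one : ∀ (k : Kind) (C : Set ℕ), In B C → ∃ D, In C D ∧ ∀ X, In D X → (σ.f X).kind ≠ k := by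
      intro k C hC
      obtain ⟨D, hD, h | h⟩ := ramsey hC.2 (fun X => (σ.f X).kind = k)
        ((hc.comp (fun s => s.kind = k)).mono (hB.trans hC).1)
      · have hD' := hC.trans hD
        exact absurd ((h D ⟨subset_rfl, hD.2⟩).trans (h (tl D) ⟨tl_subset _, tl_infinite hD.2⟩).symm)
          (hall D hD')
      · exact ⟨D, hD, h⟩
    obtain ⟨D1, i1, j1⟩ := one .one B ⟨subset_rfl, hB.2⟩
    obtain ⟨D2, i2, j2⟩ := one .sp D1 i1
    obtain ⟨D3, i3, j3⟩ := one .sm D2 (i1.trans i2)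
    obtain ⟨D4, i4, j4⟩ := one .sh D3 ((i1.trans i2).trans i3)
    have s4 : In D4 D4 := ⟨subset_rfl, i4.2⟩
    have k4 := j4 D4 s4
    have k3 := j3 D4 i4
    have k2 := j2 D4 (i3.trans i4)
    have k1 := j1 D4 ((i2.trans i3).trans i4)
    cases h : (σ.f D4).kind <;> simp_all)
  have hA3' := hA2'.trans hA3
  have ex : ∀ X, In A3 X → ∃ i : (σ.f X).ι, ∀ j, ¬ le ((σ.f X).child i) ((σ.f (tl X)).child j) := by
    intro X hX
    by_contra hcon
    push Not at hcon
    apply hb X (hA3'.trans hX)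
    rw [le_iff]; right
    exact ⟨h3 X hX, h1 X (hA2.trans (hA3.trans hX)), h2 X (hA3.trans hX), hcon⟩
  classical
  let pick : Code.{u} → Code.{u} → Code.{u} := fun s t =>
    if h : ∃ i : s.ι, ∀ j, ¬ le (s.child i) (t.child j) then s.child h.choose else s
  have hp : ∀ X, In A3 X → ∃ i : (σ.f X).ι, pick (σ.f X) (σ.f (tl X)) = (σ.f X).child i ∧
      ∀ j, ¬ le ((σ.f X).child i) ((σ.f (tl X)).child j) := by
    intro X hX
    refine ⟨(ex X hX).choose, ?_, (ex X hX).choose_spec⟩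
    simp only [pick]
    rw [dif_pos (ex X hX)]
  refine hmin A3 (fun X => pick (σ.f X) (σ.f (tl X))) hA3' ((hc.comp2 pick).mono hA3'.1) ?_ ?_
  · intro X hX
    obtain ⟨i, e, hi⟩ := hp X hX
    obtain ⟨i', e', -⟩ := hp (tl X) hX.tl
    simp only [e, e']
    exact hi i'
  · intro X hX
    obtain ⟨i, e, hi⟩ := hp X hX
    simp only [e]
    exact .single ⟨i, rfl⟩

theorem code_wqo (t : ℕ → Code.{u}) : ∃ n m, n < m ∧ le (t n) (t m) := by
  by_contra hcon
  push Not at hcon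
  let σ : Arr Code.{u} :=
    { A := Set.univ
      N := fun X => sInf X + 1
      f := fun X => t (sInf X)
      inf := Set.infinite_univ
      cell := by
        intro X Y hX hY ha
        have : sInf Y = sInf X := by
          have h1 : sInf X ∈ X := Nat.sInf_mem hX.2.nonempty
          have h2 : sInf X ∈ Y := (ha _ (Nat.lt_succ_self _)).1 h1
          apply le_antisymm (Nat.sInf_le h2)
          by_contra hlt
          have h3 : sInf Y ∈ Y := Nat.sInf_mem hY.2.nonempty
          have h4 : sInf Y ∈ X := (ha _ (by omega)).2 h3
          exact hlt (Nat.sInf_le h4)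
        simp only [this, and_self] }
  refine no_bad σ ?_
  intro X hX
  refine hcon _ _ ?_
  have h3 : sInf (tl X) ∈ tl X := Nat.sInf_mem (tl_infinite hX.2).nonempty
  obtain ⟨h4, j, hj, hjk⟩ := h3
  exact (Nat.sInf_le hj).trans_lt hjk
end LV

namespace LV
universe u

/-- finite ordered concatenations of sets satisfying `P` -/
inductive FS {L : Type u} [LinearOrder L] (P : Set L → Prop) : Set L → Prop
  | nil : FS P ∅
  | cons {A B : Set L} : P A → FS P B → (∀ x ∈ A, ∀ y ∈ B, x < y) → FS P (A ∪ B)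

section
variable {L : Type u} [LinearOrder L] {P Q : Set L → Prop}

lemma FS.mono (h : ∀ A, P A → Q A) {A : Set L} (hA : FS P A) : FS Q A := by
  induction hA with
  | nil => exact .nil
  | cons h1 _ h3 ih => exact .cons (h _ h1) ih h3

lemma FS.single {A : Set L} (h : P A) : FS P A := by
  have := FS.cons h (FS.nil (P := P)) (by simp)
  simpa using this

lemma FS.append {A B : Set L} (hA : FS P A) (hB : FS P B) (h : ∀ x ∈ A, ∀ y ∈ B, x < y) :
    FS P (A ∪ B) := by
  induction hA with
  | nil => simpa using hB
  | cons h1 _ h3 ih =>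
    rw [Set.union_assoc]
    refine .cons h1 (ih fun x hx => h x (Or.inr hx)) ?_
    rintro x hx y (hy | hy)
    · exact h3 x hx y hy
    · exact h x (Or.inl hx) y hy
end

def Emb {L L' : Type u} [LinearOrder L] [LinearOrder L'] (A : Set L) (A' : Set L') : Prop :=
  ∃ f : L → L', (∀ x ∈ A, f x ∈ A') ∧ ∀ x ∈ A, ∀ y ∈ A, x < y → f x < f y

section
variable {L L' : Type u} [LinearOrder L] [LinearOrder L']

lemma Emb.mono {A : Set L} {A' B' : Set L'} (h : Emb A A') (hB : A' ⊆ B') : Emb A B' := by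
  obtain ⟨f, h1, h2⟩ := h
  exact ⟨f, fun x hx => hB (h1 x hx), h2⟩

lemma Emb.mono_left {A B : Set L} {A' : Set L'} (h : Emb A A') (hB : B ⊆ A) : Emb B A' := by
  obtain ⟨f, h1, h2⟩ := h
  exact ⟨f, fun x hx => h1 x (hB hx), fun x hx y hy => h2 x (hB hx) y (hB hy)⟩

lemma Emb.empty [Nonempty L'] (A' : Set L') : Emb (∅ : Set L) A' :=
  ⟨fun _ => Classical.arbitrary _, by simp, by simp⟩

lemma Emb.union {A B : Set L} {A' B' : Set L'} (hA : Emb A A') (hB : Emb B B')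
    (h : ∀ x ∈ A, ∀ y ∈ B, x < y) (h' : ∀ x ∈ A', ∀ y ∈ B', x < y) : Emb (A ∪ B) (A' ∪ B') := by
  classical
  obtain ⟨f, f1, f2⟩ := hA
  obtain ⟨g, g1, g2⟩ := hB
  have hd : ∀ x ∈ B, x ∉ A := fun x hx hx' => lt_irrefl _ (h x hx' x hx)
  refine ⟨fun x => if x ∈ A then f x else g x, ?_, ?_⟩
  · rintro x (hx | hx)
    · simp only [hx, if_true]; exact Or.inl (f1 x hx)
    · simp only [hd x hx, if_false]; exact Or.inr (g1 x hx)
  · rintro x (hx | hx) y (hy | hy) hxy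
    · simp only [hx, hy, if_true]; exact f2 x hx y hy hxy
    · simp only [hx, hd y hy, if_true, if_false]; exact h' _ (f1 x hx) _ (g1 y hy)
    · exact absurd hxy (not_lt_of_gt (h y hy x hx))
    · simp only [hd x hx, hd y hy, if_false]; exact g2 x hx y hy hxy
end

/-- directed strict order -/
def dlt {L : Type*} [LT L] (d : Bool) (x y : L) : Prop := if d then x < y else y < x

def Reg (a : Ordinal.{u}) : Prop :=
  0 < a ∧ (∀ ξ < a, Order.succ ξ < a) ∧
  ∀ ξ < a, ∀ b : Ordinal.{u} → Ordinal.{u}, (∀ ζ < ξ, b ζ < a) → ∃ β < a, ∀ ζ < ξ, b ζ < β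

lemma ord_rec {a a' : Ordinal.{u}} (hreg : Reg a') (haa : a ≤ a')
    (Z : Ordinal.{u} → Ordinal.{u} → Ordinal.{u}) (hZ : ∀ ξ < a, ∀ ζ < a', Z ξ ζ < a') :
    ∃ lo : Ordinal.{u} → Ordinal.{u}, (∀ ξ < a, lo ξ < a') ∧
      ∀ ξ < a, ∀ ζ < ξ, Z ζ (lo ζ) < lo ξ := by
  classical
  let pick : Ordinal.{u} → (Ordinal.{u} → Ordinal.{u}) → Ordinal.{u} := fun ξ b =>
    if h : ∃ β < a', ∀ ζ < ξ, b ζ < β then h.choose else 0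
  let wf : WellFounded (fun x y : Ordinal.{u} => x < y) := wellFounded_lt
  let lo : Ordinal.{u} → Ordinal.{u} := wf.fix
    (fun ξ ih => pick ξ (fun ζ => if h : ζ < ξ then Z ζ (ih ζ h) else 0))
  have hlo : ∀ ξ, lo ξ = pick ξ (fun ζ => if ζ < ξ then Z ζ (lo ζ) else 0) := by
    intro ξ
    simp only [lo]
    rw [wf.fix_eq]
    simp only [dite_eq_ite]
  have key : ∀ ξ < a, lo ξ < a' ∧ ∀ ζ < ξ, Z ζ (lo ζ) < lo ξ := by
    intro ξ
    induction ξ using WellFoundedLT.induction with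
    | ind ξ ih =>
      intro hξ
      have hex : ∃ β < a', ∀ ζ < ξ, (fun ζ => if ζ < ξ then Z ζ (lo ζ) else 0) ζ < β := by
        apply hreg.2.2 ξ (hξ.trans_le haa)
        intro ζ hζ
        simp only [hζ, if_true]
        exact hZ ζ (hζ.trans hξ) _ (ih ζ hζ (hζ.trans hξ)).1
      have e : lo ξ = hex.choose := by
        rw [hlo]; simp only [pick]; rw [dif_pos hex]
      have := hex.choose_spec
      rw [← e] at this
      refine ⟨this.1, fun ζ hζ => ?_⟩
      simpa [hζ] using this.2 ζ hζ
  exact ⟨lo, fun ξ h => (key ξ h).1, fun ξ h => (key ξ h).2⟩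

section
variable {L L' : Type u} [LinearOrder L] [LinearOrder L']

lemma sum_emb [Nonempty L'] (d : Bool) {a a' : Ordinal.{u}} (haa : a ≤ a') (hreg : Reg a')
    {A : Set L} {A' : Set L'} {p : L → Ordinal.{u}} {p' : L' → Ordinal.{u}}
    (hp : ∀ x ∈ A, p x < a) (hpm : ∀ x ∈ A, ∀ y ∈ A, p x < p y → dlt d x y)
    (hpm' : ∀ x ∈ A', ∀ y ∈ A', p' x < p' y → dlt d x y)
    {F : Set L → Prop} (hF : ∀ ξ < a, FS F {x | x ∈ A ∧ p x = ξ})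
    (hE : ∀ K, F K → ∀ ζ < a', ∃ B ⊆ A', (∀ x ∈ B, ζ ≤ p' x) ∧ (∃ ξ < a', ∀ x ∈ B, p' x ≤ ξ) ∧
      Emb K B) : Emb A A' := by
  classical
  have claim : ∀ K, FS F K → ∀ ζ < a', ∃ ζ' < a', Emb K {y | y ∈ A' ∧ ζ ≤ p' y ∧ p' y ≤ ζ'} := by
    intro K hK
    induction hK with
    | nil => exact fun ζ hζ => ⟨ζ, hζ, Emb.empty _⟩
    | @cons K1 K2 h1 h2 h3 ih =>
      intro ζ hζ
      cases d with
      | true =>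
        obtain ⟨B, hBA, hB1, ⟨ξ, hξ, hB2⟩, e1⟩ := hE K1 h1 ζ hζ
        obtain ⟨ζ', hζ', e2⟩ := ih (max ζ (Order.succ ξ)) (max_lt hζ (hreg.2.1 ξ hξ))
        refine ⟨max ξ ζ', max_lt hξ hζ', ?_⟩
        refine (e1.union e2 h3 ?_).mono ?_
        · rintro x hx y ⟨hy, hy1, hy2⟩
          have := hpm' x (hBA hx) y hy
            ((hB2 x hx).trans_lt (Order.succ_le_iff.1 ((le_max_right _ _).trans hy1)))
          simpa [dlt] using this
        · rintro x (hx | ⟨hx, hx1, hx2⟩)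
          · exact ⟨hBA hx, hB1 x hx, (hB2 x hx).trans (le_max_left _ _)⟩
          · exact ⟨hx, (le_max_left _ _).trans hx1, hx2.trans (le_max_right _ _)⟩
      | false =>
        obtain ⟨ζ', hζ', e2⟩ := ih ζ hζ
        obtain ⟨B, hBA, hB1, ⟨ξ, hξ, hB2⟩, e1⟩ := hE K1 h1 (max ζ (Order.succ ζ'))
          (max_lt hζ (hreg.2.1 ζ' hζ'))
        refine ⟨max ξ ζ', max_lt hξ hζ', ?_⟩
        refine (e1.union e2 h3 ?_).mono ?_
        · rintro x hx y ⟨hy, hy1, hy2⟩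
          have := hpm' y hy x (hBA hx)
            (hy2.trans_lt (Order.succ_le_iff.1 ((le_max_right _ _).trans (hB1 x hx))))
          simpa [dlt] using this
        · rintro x (hx | ⟨hx, hx1, hx2⟩)
          · exact ⟨hBA hx, (le_max_left _ _).trans (hB1 x hx), (hB2 x hx).trans (le_max_left _ _)⟩
          · exact ⟨hx, hx1, hx2.trans (le_max_right _ _)⟩
  have claim2 : ∀ ξ ζ : Ordinal.{u}, ∃ ζ' : Ordinal.{u}, ∃ f : L → L', ξ < a → ζ < a' → ζ' < a' ∧
      (∀ x, x ∈ A → p x = ξ → f x ∈ A' ∧ ζ ≤ p' (f x) ∧ p' (f x) ≤ ζ') ∧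
      (∀ x ∈ A, ∀ y ∈ A, p x = ξ → p y = ξ → x < y → f x < f y) := by
    intro ξ ζ
    by_cases h : ξ < a ∧ ζ < a'
    · obtain ⟨ζ', hζ', f, f1, f2⟩ := claim _ (hF ξ h.1) ζ h.2
      exact ⟨ζ', f, fun _ _ => ⟨hζ', fun x hx e => f1 x ⟨hx, e⟩,
        fun x hx y hy e e' => f2 x ⟨hx, e⟩ y ⟨hy, e'⟩⟩⟩
    · exact ⟨0, fun _ => Classical.arbitrary _, fun h1 h2 => absurd ⟨h1, h2⟩ h⟩
  choose Z f hf using claim2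
  obtain ⟨lo, hlo1, hlo2⟩ := ord_rec hreg haa Z (fun ξ hξ ζ hζ => (hf ξ ζ hξ hζ).1)
  have hm : ∀ x ∈ A, f (p x) (lo (p x)) x ∈ A' ∧ lo (p x) ≤ p' (f (p x) (lo (p x)) x) ∧
      p' (f (p x) (lo (p x)) x) ≤ Z (p x) (lo (p x)) := fun x hx =>
    (hf (p x) (lo (p x)) (hp x hx) (hlo1 _ (hp x hx))).2.1 x hx rfl
  refine ⟨fun x => f (p x) (lo (p x)) x, fun x hx => (hm x hx).1, fun x hx y hy hxy => ?_⟩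
  have cross : ∀ x ∈ A, ∀ y ∈ A, p x < p y →
      dlt d (f (p x) (lo (p x)) x) (f (p y) (lo (p y)) y) := by
    intro x hx y hy hlt
    apply hpm' _ (hm x hx).1 _ (hm y hy).1
    exact (hm x hx).2.2.trans_lt ((hlo2 _ (hp y hy) _ hlt).trans_le (hm y hy).2.1)
  rcases lt_trichotomy (p x) (p y) with h | h | h
  · have h1 := hpm x hx y hy h
    have h2 := cross x hx y hy h
    cases d
    · simp [dlt] at h1; exact absurd h1 (not_lt_of_gt hxy)
    · simpa [dlt] using h2
  · have := (hf (p x) (lo (p x)) (hp x hx) (hlo1 _ (hp x hx))).2.2 x hx y hy rfl h.symm hxy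
    simpa [h] using this
  · have h1 := hpm y hy x hx h
    have h2 := cross y hy x hx h
    cases d
    · simpa [dlt] using h2
    · simp [dlt] at h1; exact absurd h1 (not_lt_of_gt hxy)
end
end LV

namespace LV
universe u

lemma cofinal_p {M : Type u} [LinearOrder M] (B : Set M) (hne : B.Nonempty)
    (hno : ∀ x ∈ B, ∃ y ∈ B, x < y) : ∃ (a : Ordinal.{u}) (p : M → Ordinal.{u}), Reg a ∧
      (∀ x ∈ B, p x < a) ∧ (∀ x ∈ B, ∀ y ∈ B, p x < p y → x < y) ∧
      ∀ ξ < a, ∃ y ∈ B, ∀ x ∈ B, p x ≤ ξ → x ≤ y := by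
  classical
  obtain ⟨x0, hx0⟩ := hne
  let C : Ordinal.{u} → Prop := fun a => ∃ h : Ordinal.{u} → M, (∀ ξ, h ξ ∈ B) ∧
    ∀ y ∈ B, ∃ ξ < a, y ≤ h ξ
  have hC : ∃ a, C a := by
    let f : M → Ordinal.{u} := fun x => Ordinal.typein (WellOrderingRel (α := M)) x
    have hf : Function.Injective f := Ordinal.typein_injective _
    have : Nonempty M := ⟨x0⟩
    refine ⟨Ordinal.type (WellOrderingRel (α := M)),
      fun ξ => if Function.invFun f ξ ∈ B then Function.invFun f ξ else x0, ?_, ?_⟩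
    · intro ξ
      by_cases h : Function.invFun f ξ ∈ B <;> simp [h, hx0]
    · intro y hy
      refine ⟨f y, Ordinal.typein_lt_type _ y, ?_⟩
      simp [Function.leftInverse_invFun hf y, hy]
  obtain ⟨a, ha, hmin⟩ : ∃ a, C a ∧ ∀ b < a, ¬ C b :=
    ⟨wellFounded_lt.min {a | C a} hC, wellFounded_lt.min_mem {a | C a} hC,
      fun b hb h => wellFounded_lt.not_lt_min {a | C a} h hb⟩
  obtain ⟨h, hB, hcof⟩ := ha
  have bnd : ∀ ξ < a, ∃ y ∈ B, ∀ ζ < ξ, h ζ < y := by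
    intro ξ hξ
    by_contra hcon
    push Not at hcon
    exact hmin ξ hξ ⟨h, hB, hcon⟩
  let p : M → Ordinal.{u} := fun y => sInf {ξ | y ≤ h ξ}
  have hple : ∀ y ξ, y ≤ h ξ → p y ≤ ξ := fun y ξ hy => csInf_le' hy
  have hpa : ∀ y ∈ B, p y < a := fun y hy => by
    obtain ⟨ξ, h1, h2⟩ := hcof y hy
    exact (hple y ξ h2).trans_lt h1
  have hyp : ∀ y ∈ B, y ≤ h (p y) := fun y hy => by
    obtain ⟨ξ, h1, h2⟩ := hcof y hy
    exact csInf_mem (s := {ξ | y ≤ h ξ}) ⟨ξ, h2⟩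
  have hpos : 0 < a := (zero_le (a := p x0)).trans_lt (hpa x0 hx0)
  have hsucc : ∀ ξ < a, Order.succ ξ < a := by
    intro ξ hξ
    refine lt_of_le_of_ne (Order.succ_le_iff.2 hξ) fun e => ?_
    obtain ⟨y0, hy0, hb⟩ := bnd ξ hξ
    have : max y0 (h ξ) ∈ B := by
      rcases max_choice y0 (h ξ) with h | h <;> rw [h]
      · exact hy0
      · exact hB _
    obtain ⟨y2, hy2, hlt⟩ := hno _ this
    obtain ⟨ζ, hζ, hle⟩ := hcof y2 hy2
    rw [← e, Order.lt_succ_iff] at hζ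
    rcases hζ.eq_or_lt with rfl | hζ
    · exact absurd (hlt.trans_le hle) (not_lt_of_ge (le_max_right _ _))
    · exact absurd ((hlt.trans_le hle).trans (hb ζ hζ)) (not_lt_of_ge (le_max_left _ _))
  have bnd2 : ∀ ξ < a, ∃ y ∈ B, ∀ x ∈ B, p x ≤ ξ → x ≤ y := by
    intro ξ hξ
    obtain ⟨y, hy, hb⟩ := bnd _ (hsucc ξ hξ)
    exact ⟨y, hy, fun x hx hxξ => (hyp x hx).trans (hb _ (Order.lt_succ_iff.2 hxξ)).le⟩
  refine ⟨a, p, ⟨hpos, hsucc, ?_⟩, hpa, ?_, bnd2⟩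
  · intro ξ hξ b hb
    by_contra hcon
    push Not at hcon
    have : ∀ ζ, ∃ y ∈ B, ζ < ξ → ∀ x ∈ B, p x ≤ b ζ → x ≤ y := by
      intro ζ
      by_cases hζ : ζ < ξ
      · obtain ⟨y, hy, hy2⟩ := bnd2 _ (hb ζ hζ)
        exact ⟨y, hy, fun _ => hy2⟩
      · exact ⟨x0, hx0, fun h => absurd h hζ⟩
    choose h' h1 h2 using this
    refine hmin ξ hξ ⟨h', h1, fun y hy => ?_⟩
    obtain ⟨ζ, hζ, hle⟩ := hcon _ (hpa y hy)
    exact ⟨ζ, hζ, h2 ζ hζ y hy hle⟩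
  · intro x hx y hy hlt
    by_contra hcon
    exact not_lt_of_ge (hple y _ ((not_lt.1 hcon).trans (hyp x hx))) hlt

theorem hausdorff {M : Type u} [LinearOrder M] (G : Set M → Prop) (g0 : G ∅) (g1 : ∀ x, G {x})
    (gu : ∀ A B, G A → G B → (∀ x ∈ A, ∀ y ∈ B, x < y) → G (A ∪ B))
    (gs : ∀ (d : Bool) (a : Ordinal.{u}) (p : M → Ordinal.{u}) (A : Set M), Reg a →
      (∀ x ∈ A, p x < a) → (∀ x ∈ A, ∀ y ∈ A, p x < p y → dlt d x y) →
      (∀ ξ < a, G {x | x ∈ A ∧ p x = ξ}) → (∀ ξ < a, G {x | x ∈ A ∧ p x < ξ}) → G A) :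
    ∃ r : M → M, Monotone r ∧ (∀ x y, r x < r y → ∃ z, r x < r z ∧ r z < r y) ∧
      (∀ B : Set M, B.OrdConnected → (∀ x ∈ B, ∀ y ∈ B, r x = r y) → G B) ∧
      (∀ x y, x ≤ y → (∀ B ⊆ Set.Icc x y, B.OrdConnected → G B) → r x = r y) := by
  classical
  let hG : Set M → Prop := fun A => ∀ B ⊆ A, B.OrdConnected → G B
  have hGm : ∀ A B, hG A → B ⊆ A → hG B := fun A B h hBA C hC => h C (hC.trans hBA)
  let sim : M → M → Prop := fun x y => hG (Set.uIcc x y)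
  have srefl : ∀ x, sim x x := by
    intro x B hB _
    rw [Set.uIcc_self] at hB
    rcases Set.subset_singleton_iff_eq.1 hB with rfl | rfl
    · exact g0
    · exact g1 x
  have ssymm : ∀ x y, sim x y → sim y x := fun x y h => by
    simp only [sim]; rw [Set.uIcc_comm]; exact h
  have split : ∀ (y : M) (C : Set M), hG (C ∩ Set.Iic y) → hG (C ∩ Set.Ici y) → hG C := by
    intro y C h1 h2 B hB hBc
    have e : B = (B ∩ Set.Iic y) ∪ (B ∩ Set.Ioi y) := by
      rw [← Set.inter_union_distrib_left, Set.Iic_union_Ioi, Set.inter_univ]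
    rw [e]
    apply gu
    · exact h1 _ (Set.inter_subset_inter_left _ hB) (hBc.inter Set.ordConnected_Iic)
    · exact h2 _ (Set.inter_subset_inter hB Set.Ioi_subset_Ici_self) (hBc.inter Set.ordConnected_Ioi)
    · rintro a ⟨_, ha⟩ b ⟨_, hb⟩
      exact lt_of_le_of_lt ha hb
  have strans' : ∀ x y z, x ≤ z → sim x y → sim y z → sim x z := by
    intro x y z hxz h1 h2
    rcases le_total x y with hxy | hxy
    · rcases le_total y z with hyz | hyz
      · apply split y
        · refine hGm _ _ h1 ?_
          rw [Set.uIcc_of_le hxz, Set.uIcc_of_le hxy]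
          rintro w ⟨hw, hw'⟩; exact ⟨hw.1, hw'⟩
        · refine hGm _ _ h2 ?_
          rw [Set.uIcc_of_le hxz, Set.uIcc_of_le hyz]
          rintro w ⟨hw, hw'⟩; exact ⟨hw', hw.2⟩
      · refine hGm _ _ h1 ?_
        rw [Set.uIcc_of_le hxz, Set.uIcc_of_le hxy]
        exact Set.Icc_subset_Icc_right hyz
    · refine hGm _ _ h2 ?_
      rw [Set.uIcc_of_le hxz, Set.uIcc_of_le (hxy.trans hxz)]
      exact Set.Icc_subset_Icc_left hxy
  have strans : ∀ x y z, sim x y → sim y z → sim x z := by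
    intro x y z h1 h2
    rcases le_total x z with h | h
    · exact strans' x y z h h1 h2
    · exact ssymm _ _ (strans' z y x h (ssymm _ _ h2) (ssymm _ _ h1))
  have sconv1 : ∀ x y z, x ≤ y → y ≤ z → sim x z → sim x y := by
    intro x y z hxy hyz h
    refine hGm _ _ h ?_
    rw [Set.uIcc_of_le hxy, Set.uIcc_of_le (hxy.trans hyz)]
    exact Set.Icc_subset_Icc_right hyz
  have sconv2 : ∀ x y z, x ≤ y → y ≤ z → sim x z → sim y z := fun x y z h1 h2 h =>
    strans _ _ _ (ssymm _ _ (sconv1 x y z h1 h2 h)) h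
  have up : ∀ (C : Set M) (x0 : M), C.OrdConnected → (∀ y ∈ C, x0 ≤ y ∧ sim x0 y) → G C := by
    intro C x0 hC hs
    rcases C.eq_empty_or_nonempty with rfl | hne
    · exact g0
    by_cases hmax : ∃ m ∈ C, ∀ y ∈ C, y ≤ m
    · obtain ⟨m, hm, hm2⟩ := hmax
      refine (hs m hm).2 C ?_ hC
      rw [Set.uIcc_of_le (hs m hm).1]
      exact fun y hy => ⟨(hs y hy).1, hm2 y hy⟩
    push Not at hmax
    obtain ⟨a, p, hreg, hpa, hpm, hb⟩ := cofinal_p C hne hmax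
    have hb2 : ∀ ξ < a, ∀ D ⊆ C, D.OrdConnected → (∀ x ∈ D, p x ≤ ξ) → G D := by
      intro ξ hξ D hD hDc hDp
      obtain ⟨y, hy, hy2⟩ := hb ξ hξ
      refine (hs y hy).2 D ?_ hDc
      rw [Set.uIcc_of_le (hs y hy).1]
      exact fun w hw => ⟨(hs w (hD hw)).1, hy2 w (hD hw) (hDp w hw)⟩
    have hpm2 : ∀ x ∈ C, ∀ y ∈ C, x ≤ y → p x ≤ p y := by
      intro x hx y hy hxy
      by_contra hcon
      exact not_lt_of_ge hxy (hpm y hy x hx (not_le.1 hcon))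
    refine gs true a p C hreg hpa (by simpa [dlt] using hpm) ?_ ?_
    · intro ξ hξ
      refine hb2 ξ hξ _ (fun x hx => hx.1) ⟨?_⟩ (fun x hx => hx.2.le)
      rintro x ⟨hx, ex⟩ y ⟨hy, ey⟩ z hz
      have hzC := hC.out hx hy hz
      exact ⟨hzC, le_antisymm (ey ▸ hpm2 z hzC y hy hz.2) (ex ▸ hpm2 x hx z hzC hz.1)⟩
    · intro ξ hξ
      refine hb2 ξ hξ _ (fun x hx => hx.1) ⟨?_⟩ (fun x hx => hx.2.le)
      rintro x ⟨hx, ex⟩ y ⟨hy, ey⟩ z hz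
      have hzC := hC.out hx hy hz
      exact ⟨hzC, (hpm2 z hzC y hy hz.2).trans_lt ey⟩
  have down : ∀ (C : Set M) (x0 : M), C.OrdConnected → (∀ y ∈ C, y ≤ x0 ∧ sim x0 y) → G C := by
    intro C x0 hC hs
    rcases C.eq_empty_or_nonempty with rfl | hne
    · exact g0
    by_cases hmax : ∃ m ∈ C, ∀ y ∈ C, m ≤ y
    · obtain ⟨m, hm, hm2⟩ := hmax
      refine (hs m hm).2 C ?_ hC
      rw [Set.uIcc_of_ge (hs m hm).1]
      exact fun y hy => ⟨hm2 y hy, (hs y hy).1⟩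
    push Not at hmax
    obtain ⟨a, p, hreg, hpa, hpm, hb⟩ := cofinal_p (M := Mᵒᵈ) C hne hmax
    have hpm : ∀ x ∈ C, ∀ y ∈ C, p x < p y → y < x := hpm
    have hb : ∀ ξ < a, ∃ y ∈ C, ∀ x ∈ C, p x ≤ ξ → y ≤ x := hb
    have hb2 : ∀ ξ < a, ∀ D ⊆ C, D.OrdConnected → (∀ x ∈ D, p x ≤ ξ) → G D := by
      intro ξ hξ D hD hDc hDp
      obtain ⟨y, hy, hy2⟩ := hb ξ hξ
      refine (hs y hy).2 D ?_ hDc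
      rw [Set.uIcc_of_ge (hs y hy).1]
      exact fun w hw => ⟨hy2 w (hD hw) (hDp w hw), (hs w (hD hw)).1⟩
    have hpm2 : ∀ x ∈ C, ∀ y ∈ C, x ≤ y → p y ≤ p x := by
      intro x hx y hy hxy
      by_contra hcon
      exact not_lt_of_ge hxy (hpm x hx y hy (not_le.1 hcon))
    refine gs false a p C hreg hpa (by simpa [dlt] using hpm) ?_ ?_
    · intro ξ hξ
      refine hb2 ξ hξ _ (fun x hx => hx.1) ⟨?_⟩ (fun x hx => hx.2.le)
      rintro x ⟨hx, ex⟩ y ⟨hy, ey⟩ z hz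
      have hzC := hC.out hx hy hz
      exact ⟨hzC, le_antisymm (ex ▸ hpm2 x hx z hzC hz.1) (ey ▸ hpm2 z hzC y hy hz.2)⟩
    · intro ξ hξ
      refine hb2 ξ hξ _ (fun x hx => hx.1) ⟨?_⟩ (fun x hx => hx.2.le)
      rintro x ⟨hx, ex⟩ y ⟨hy, ey⟩ z hz
      have hzC := hC.out hx hy hz
      exact ⟨hzC, (hpm2 x hx z hzC hz.1).trans_lt ex⟩
  have mutl : ∀ B : Set M, B.OrdConnected → (∀ x ∈ B, ∀ y ∈ B, sim x y) → G B := by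
    intro B hB hs
    rcases B.eq_empty_or_nonempty with rfl | ⟨x0, hx0⟩
    · exact g0
    have e : B = (B ∩ Set.Iic x0) ∪ (B ∩ Set.Ioi x0) := by
      rw [← Set.inter_union_distrib_left, Set.Iic_union_Ioi, Set.inter_univ]
    rw [e]
    apply gu
    · exact down _ x0 (hB.inter Set.ordConnected_Iic) fun y hy => ⟨hy.2, hs _ hx0 _ hy.1⟩
    · exact up _ x0 (hB.inter Set.ordConnected_Ioi)
        fun y hy => ⟨le_of_lt hy.2, hs _ hx0 _ hy.1⟩
    · rintro a ⟨_, ha⟩ b ⟨_, hb⟩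
      exact lt_of_le_of_lt ha hb
  have dense : ∀ x y, x < y → ¬ sim x y → ∃ z, x < z ∧ z < y ∧ ¬ sim x z ∧ ¬ sim z y := by
    intro x y hxy hn
    by_contra hcon
    push Not at hcon
    apply hn
    intro B hB hBc
    rw [Set.uIcc_of_le hxy.le] at hB
    have e : B = {z | z ∈ B ∧ sim x z} ∪ {z | z ∈ B ∧ ¬ sim x z} := by
      ext z; by_cases h : sim x z <;> simp [h]
    have hy' : ∀ z ∈ B, ¬ sim x z → sim z y := by
      intro z hz hns
      rcases (hB hz).1.eq_or_lt with rfl | h1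
      · exact absurd (srefl _) hns
      rcases (hB hz).2.eq_or_lt with rfl | h2
      · exact srefl _
      exact hcon z h1 h2 hns
    rw [e]
    apply gu
    · apply mutl
      · refine ⟨?_⟩
        rintro z ⟨hz, hsz⟩ w ⟨hw, hsw⟩ v hv
        exact ⟨hBc.out hz hw hv, sconv1 _ _ _ ((hB hz).1.trans hv.1) hv.2 hsw⟩
      · rintro z ⟨hz, hsz⟩ w ⟨hw, hsw⟩
        exact strans _ _ _ (ssymm _ _ hsz) hsw
    · apply mutl
      · refine ⟨?_⟩
        rintro z ⟨hz, hsz⟩ w ⟨hw, hsw⟩ v hv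
        refine ⟨hBc.out hz hw hv, fun hv' => hsz (sconv1 _ _ _ (hB hz).1 hv.1 hv')⟩
      · rintro z ⟨hz, hsz⟩ w ⟨hw, hsw⟩
        exact strans _ _ _ (hy' z hz hsz) (ssymm _ _ (hy' w hw hsw))
    · rintro z ⟨hz, hsz⟩ w ⟨hw, hsw⟩
      by_contra hle
      exact hsw (sconv1 _ _ _ (hB hw).1 (not_lt.1 hle) hsz)
  let S : Setoid M := ⟨sim, ⟨srefl, fun {x y} => ssymm x y, fun {x y z} => strans x y z⟩⟩
  let r : M → M := fun x => (Quotient.mk S x).out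
  have hr : ∀ x, sim (r x) x := fun x => Quotient.exact (s := S) (Quotient.out_eq _)
  have hreq : ∀ x y, sim x y → r x = r y := fun x y h => by
    simp only [r]; rw [Quotient.sound (s := S) h]
  have hreq' : ∀ x y, r x = r y → sim x y := fun x y h =>
    strans _ _ _ (ssymm _ _ (hr x)) (h ▸ hr y)
  have hrlt : ∀ x y, x < y → ¬ sim x y → r x < r y := by
    intro x y hxy hn
    by_contra hcon
    have hcon := not_lt.1 hcon
    apply hn
    rcases le_total x (r y) with h | h
    · exact strans _ _ _ (sconv1 _ _ _ h hcon (ssymm _ _ (hr x))) (hr y)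
    · exact sconv2 _ _ _ h hxy.le (hr y)
  have hmono : Monotone r := by
    intro x y hxy
    by_cases h : sim x y
    · exact (hreq x y h).le
    · rcases hxy.eq_or_lt with rfl | h'
      · rfl
      · exact (hrlt x y h' h).le
  refine ⟨r, hmono, ?_, ?_, ?_⟩
  · intro x y hlt
    have h1 : x < y := by
      by_contra h; exact not_lt_of_ge (hmono (not_lt.1 h)) hlt
    obtain ⟨z, h2, h3, h4, h5⟩ := dense x y h1 (fun h => hlt.ne (hreq _ _ h))
    exact ⟨z, hrlt _ _ h2 h4, hrlt _ _ h3 h5⟩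
  · exact fun B hB h => mutl B hB fun x hx y hy => hreq' _ _ (h x hx y hy)
  · intro x y hxy h
    apply hreq
    simp only [sim]
    rw [Set.uIcc_of_le hxy]
    exact h
end LV

namespace LV
universe u

def ll {M : Type u} [LinearOrder M] (A B : Set M) : Prop := ∀ x ∈ A, ∀ y ∈ B, x < y

lemma ll.mono {M : Type u} [LinearOrder M] {A B A' B' : Set M} (h : ll A B) (hA : A' ⊆ A)
    (hB : B' ⊆ B) : ll A' B' := fun x hx y hy => h x (hA hx) y (hB hy)

section
variable {E M' : Type u} [LinearOrder E] [LinearOrder M'] {JJ : Set (Set M')}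
  {pt : E → Set (Set M')}

def U1 (JJ : Set (Set M')) (pt : E → Set (Set M')) : Prop := ∀ J ∈ JJ, ∀ e, ∃ B ∈ pt e, B ⊆ J

def U2 (E : Type u) [LinearOrder E] (JJ : Set (Set M')) : Prop :=
  ∀ (d : Bool) (W : Set E) (p : E → Ordinal.{u}),
  (∀ x ∈ W, ∀ y ∈ W, p x < p y → dlt d x y) → (∀ x ∈ W, ∀ y ∈ W, p x = p y → x = y) →
  ∀ J ∈ JJ, ∃ K : E → Set M', (∀ w ∈ W, K w ∈ JJ ∧ K w ⊆ J) ∧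
    ∀ w ∈ W, ∀ w' ∈ W, w < w' → ll (K w) (K w')

lemma one_step (u1 : U1 JJ pt) (u2 : U2 E JJ) (S : Set E) (hS : Scattered S) (J : Set M')
    (hJ : J ∈ JJ) : ∃ F : E → Set M', (∀ e, F e ⊆ J) ∧ (∀ e ∈ S, F e ∈ pt e) ∧
      (∀ e, e ∉ S → F e ∈ JJ) ∧
      ∀ e e', e < e' → ll (F e) (F e') ∨ (F e = F e' ∧ ∀ z ∈ S, ¬ (e ≤ z ∧ z ≤ e')) := by
  classical
  let G : Set E → Prop := fun X => ∀ J ∈ JJ, ∃ F : E → Set M', (∀ e ∈ X, F e ⊆ J) ∧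
    (∀ e ∈ X, e ∈ S → F e ∈ pt e) ∧ (∀ e ∈ X, e ∉ S → F e ∈ JJ) ∧
      ∀ e ∈ X, ∀ e' ∈ X, e < e' → ll (F e) (F e') ∨ (F e = F e' ∧ ∀ z ∈ S, ¬ (e ≤ z ∧ z ≤ e'))
  have g0 : G ∅ := fun J _ => ⟨fun _ => ∅, by simp, by simp, by simp, by simp⟩
  have g1 : ∀ x, G {x} := by
    intro x J hJ
    obtain ⟨B, hB, hBJ⟩ := u1 J hJ x
    refine ⟨fun _ => if x ∈ S then B else J, ?_, ?_, ?_, ?_⟩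
    · rintro e rfl
      by_cases h : e ∈ S <;> simp [h, hBJ]
    · rintro e rfl h; simpa [h] using hB
    · rintro e rfl h; simpa [h] using hJ
    · rintro e rfl e' rfl h; exact absurd h (lt_irrefl _)
  have gen : ∀ (d : Bool) (p : E → Ordinal.{u}) (A : Set E),
      (∀ x ∈ A, ∀ y ∈ A, p x < p y → dlt d x y) → (∀ ξ, G {x | x ∈ A ∧ p x = ξ}) → G A := by
    intro d p A hp hG J hJ
    have hw : ∀ x : E, ∃ w : E, x ∈ A → w ∈ A ∧ p w = p x := fun x => ⟨x, fun h => ⟨h, rfl⟩⟩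
    by_cases hne : A.Nonempty
    swap
    · rw [Set.not_nonempty_iff_eq_empty] at hne
      subst hne; exact g0 J hJ
    obtain ⟨x0, hx0⟩ := hne
    let w : Ordinal.{u} → E := fun ξ => if h : ∃ x ∈ A, p x = ξ then h.choose else x0
    have hw : ∀ x ∈ A, w (p x) ∈ A ∧ p (w (p x)) = p x := by
      intro x hx
      have h : ∃ y ∈ A, p y = p x := ⟨x, hx, rfl⟩
      simp only [w]; rw [dif_pos h]; exact h.choose_spec
    obtain ⟨K, hK1, hK2⟩ := u2 d {x | x ∈ A ∧ x = w (p x)} p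
      (fun x hx y hy => hp x hx.1 y hy.1)
      (fun x hx y hy h => by rw [hx.2, hy.2, h]) J hJ
    have hW : ∀ x ∈ A, w (p x) ∈ {x | x ∈ A ∧ x = w (p x)} := fun x hx =>
      ⟨(hw x hx).1, by rw [(hw x hx).2]⟩
    have : ∀ (ξ : Ordinal.{u}) (J : Set M'), ∃ F : E → Set M', J ∈ JJ →
        (∀ e ∈ {x | x ∈ A ∧ p x = ξ}, F e ⊆ J) ∧
        (∀ e ∈ {x | x ∈ A ∧ p x = ξ}, e ∈ S → F e ∈ pt e) ∧
        (∀ e ∈ {x | x ∈ A ∧ p x = ξ}, e ∉ S → F e ∈ JJ) ∧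
        ∀ e ∈ {x | x ∈ A ∧ p x = ξ}, ∀ e' ∈ {x | x ∈ A ∧ p x = ξ}, e < e' →
          ll (F e) (F e') ∨ (F e = F e' ∧ ∀ z ∈ S, ¬ (e ≤ z ∧ z ≤ e')) := by
      intro ξ J
      by_cases hJ : J ∈ JJ
      · obtain ⟨F, hF⟩ := hG ξ J hJ
        exact ⟨F, fun _ => hF⟩
      · exact ⟨fun _ => ∅, fun h => absurd h hJ⟩
    choose Fn hFn using this
    have hFx : ∀ x ∈ A, K (w (p x)) ∈ JJ := fun x hx => (hK1 _ (hW x hx)).1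
    refine ⟨fun x => Fn (p x) (K (w (p x))) x, ?_, ?_, ?_, ?_⟩
    · intro x hx
      exact ((hFn (p x) _ (hFx x hx)).1 x ⟨hx, rfl⟩).trans (hK1 _ (hW x hx)).2
    · intro x hx hxS
      exact (hFn (p x) _ (hFx x hx)).2.1 x ⟨hx, rfl⟩ hxS
    · intro x hx hxS
      exact (hFn (p x) _ (hFx x hx)).2.2.1 x ⟨hx, rfl⟩ hxS
    · intro x hx y hy hxy
      by_cases he : p x = p y
      · have := (hFn (p x) _ (hFx x hx)).2.2.2 x ⟨hx, rfl⟩ y ⟨hy, he.symm⟩ hxy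
        simpa [he] using this
      · left
        have hlt : w (p x) < w (p y) := by
          have hx' := hw x hx
          have hy' := hw y hy
          rcases lt_or_gt_of_ne he with h | h
          · have h1 := hp x hx y hy h
            have h2 := hp _ hx'.1 _ hy'.1 (by rw [hx'.2, hy'.2]; exact h)
            cases d
            · simp [dlt] at h1; exact absurd h1 (not_lt_of_gt hxy)
            · simpa [dlt] using h2
          · have h1 := hp y hy x hx h
            have h2 := hp _ hy'.1 _ hx'.1 (by rw [hx'.2, hy'.2]; exact h)
            cases d
            · simpa [dlt] using h2
            · simp [dlt] at h1; exact absurd h1 (not_lt_of_gt hxy)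
        exact (hK2 _ (hW x hx) _ (hW y hy) hlt).mono
          ((hFn (p x) _ (hFx x hx)).1 x ⟨hx, rfl⟩) ((hFn (p y) _ (hFx y hy)).1 y ⟨hy, rfl⟩)
  have gu : ∀ A B, G A → G B → (∀ x ∈ A, ∀ y ∈ B, x < y) → G (A ∪ B) := by
    intro A B hA hB hAB
    have hd : ∀ x ∈ B, x ∉ A := fun x hx hx' => lt_irrefl _ (hAB x hx' x hx)
    refine gen true (fun x => if x ∈ A then 0 else 1) _ ?_ ?_
    · intro x hx y hy h
      by_cases h1 : x ∈ A <;> by_cases h2 : y ∈ A <;> simp [h1, h2] at h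
      rcases hy with hy | hy
      · exact absurd hy h2
      · simpa [dlt] using hAB x h1 y hy
    · intro ξ
      by_cases h0 : ξ = 0
      · convert hA using 1
        ext x; subst h0
        by_cases h1 : x ∈ A <;> simp [h1]
      by_cases h0' : ξ = 1
      · convert hB using 1
        ext x; subst h0'
        by_cases h1 : x ∈ A <;> simp [h1]
        exact fun h => hd x h h1
      · convert g0 using 1
        ext x
        by_cases h1 : x ∈ A <;> simp [h1, Ne.symm h0, Ne.symm h0']
  obtain ⟨r, hr, hden, hG1, hG2⟩ := hausdorff G g0 g1 gu
    (fun d a p A _ hpa hp h1 _ => gen d p A hp (fun ξ => by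
      by_cases hξ : ξ < a
      · exact h1 ξ hξ
      · convert g0 using 1
        ext x
        simp only [Set.mem_ofPred_eq, Set.mem_empty_iff_false, iff_false, not_and]
        rintro hx rfl
        exact hξ (hpa x hx)))
  have hmeet : ∀ x y, r x < r y → ∃ z ∈ S, x ≤ z ∧ z ≤ y := by
    intro x y hxy
    by_contra hcon
    push Not at hcon
    have hlt : x < y := by
      by_contra h; exact not_lt_of_ge (hr (not_lt.1 h)) hxy
    refine hxy.ne (hG2 x y hlt.le ?_)
    intro B hB _ J hJ
    refine ⟨fun _ => J, fun _ _ => subset_rfl, ?_, fun _ _ _ => hJ, ?_⟩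
    · intro e he heS
      exact absurd (hcon e heS (hB he).1) (not_lt_of_ge (hB he).2)
    · intro e he e' he' _
      refine Or.inr ⟨rfl, fun z hz h => ?_⟩
      exact absurd (hcon z hz ((hB he).1.trans h.1)) (not_lt_of_ge (h.2.trans (hB he').2))
  have htriv : ∀ x y, r x = r y := by
    by_contra hcon
    push Not at hcon
    obtain ⟨x, y, hxy⟩ := hcon
    let T : Set E := Set.range r
    have : Nontrivial T := ⟨⟨r x, x, rfl⟩, ⟨r y, y, rfl⟩, fun h => hxy (congrArg Subtype.val h)⟩
    have : DenselyOrdered T := by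
      refine ⟨?_⟩
      rintro ⟨_, x, rfl⟩ ⟨_, y, rfl⟩ h
      obtain ⟨z, h1, h2⟩ := hden x y h
      exact ⟨⟨r z, z, rfl⟩, h1, h2⟩
    have : Countable (ℚ ×ₗ Bool) := inferInstanceAs (Countable (ℚ × Bool))
    obtain ⟨φ⟩ := Order.embedding_from_countable_to_dense (α := ℚ ×ₗ Bool) (β := T)
    have hx : ∀ q, ∃ x, r x = (φ q : E) := fun q => (φ q).2
    choose x hx using hx
    have hxl : ∀ q q', q < q' → r (x q) < r (x q') := by
      intro q q' h
      rw [hx, hx]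
      exact φ.strictMono h
    have hs : ∀ q : ℚ, ∃ z ∈ S, x (toLex (q, false)) ≤ z ∧ z ≤ x (toLex (q, true)) := by
      intro q
      apply hmeet
      apply hxl
      rw [Prod.Lex.toLex_lt_toLex]
      right; simp
    choose s hsS hs using hs
    refine hS.false (OrderEmbedding.ofStrictMono (fun q => (⟨s q, hsS q⟩ : S)) ?_)
    intro q q' h
    show s q < s q'
    refine (hs q).2.trans_lt (lt_of_lt_of_le ?_ (hs q').1)
    by_contra hle
    refine not_lt_of_ge (hr (not_lt.1 hle)) (hxl _ _ ?_)
    rw [Prod.Lex.toLex_lt_toLex]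
    left; exact h
  obtain ⟨F, h1, h2, h3, h4⟩ := hG1 Set.univ Set.ordConnected_univ (fun x _ y _ => htriv x y) J hJ
  exact ⟨F, fun e => h1 e trivial, fun e => h2 e trivial, fun e => h3 e trivial,
    fun e e' => h4 e trivial e' trivial⟩

theorem universal (u1 : U1 JJ pt) (u2 : U2 E JJ) (hσ : SigmaScattered E) (J0 : Set M')
    (hJ0 : J0 ∈ JJ) : ∃ F : E → Set M', (∀ e, F e ∈ pt e ∧ F e ⊆ J0) ∧
      ∀ e e', e < e' → ll (F e) (F e') := by
  classical
  obtain ⟨S, hSu, hS⟩ := hσ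
  have : ∀ (n : ℕ) (J : Set M'), ∃ F : E → Set M', J ∈ JJ → (∀ e, F e ⊆ J) ∧
      (∀ e ∈ S n, F e ∈ pt e) ∧ (∀ e, e ∉ S n → F e ∈ JJ) ∧
      ∀ e e', e < e' → ll (F e) (F e') ∨ (F e = F e' ∧ ∀ z ∈ S n, ¬ (e ≤ z ∧ z ≤ e')) := by
    intro n J
    by_cases hJ : J ∈ JJ
    · obtain ⟨F, hF⟩ := one_step u1 u2 (S n) (hS n) J hJ
      exact ⟨F, fun _ => hF⟩
    · exact ⟨fun _ => ∅, fun h => absurd h hJ⟩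
  choose Φ hΦ using this
  let St : ℕ → E → Set M' := fun n => Nat.rec (fun _ => J0)
    (fun n T e => if ∃ m < n, e ∈ S m then T e else Φ n (T e) e) n
  have hSt : ∀ n e, St (n+1) e = if ∃ m < n, e ∈ S m then St n e else Φ n (St n e) e :=
    fun _ _ => rfl
  have inv : ∀ n, (∀ e, ((∃ m < n, e ∈ S m) → St n e ∈ pt e) ∧
      ((¬ ∃ m < n, e ∈ S m) → St n e ∈ JJ)) := by
    intro n
    induction n with
    | zero => exact fun e => ⟨by simp, fun _ => hJ0⟩
    | succ n ih =>
      intro e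
      rw [hSt]
      by_cases h : ∃ m < n, e ∈ S m
      · rw [if_pos h]
        refine ⟨fun _ => (ih e).1 h, fun hn => absurd ?_ hn⟩
        obtain ⟨m, hm, he⟩ := h
        exact ⟨m, by omega, he⟩
      · rw [if_neg h]
        have hJ := hΦ n _ ((ih e).2 h)
        constructor
        · rintro ⟨m, hm, he⟩
          rcases Nat.lt_succ_iff_lt_or_eq.1 hm with h' | rfl
          · exact absurd ⟨m, h', he⟩ h
          · exact hJ.2.1 e he
        · intro hn
          exact hJ.2.2.1 e fun he => hn ⟨n, by omega, he⟩
  have sub : ∀ n e, St (n+1) e ⊆ St n e := by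
    intro n e
    rw [hSt]
    by_cases h : ∃ m < n, e ∈ S m
    · rw [if_pos h]
    · rw [if_neg h]
      exact (hΦ n _ ((inv n e).2 h)).1 e
  have sub0 : ∀ n e, St n e ⊆ J0 := by
    intro n e
    induction n with
    | zero => exact subset_rfl
    | succ n ih => exact (sub n e).trans ih
  have ord : ∀ n e e', e < e' → ll (St n e) (St n e') ∨
      (St n e = St n e' ∧ ∀ m < n, ∀ z ∈ S m, ¬ (e ≤ z ∧ z ≤ e')) := by
    intro n
    induction n with
    | zero => exact fun e e' _ => Or.inr ⟨rfl, by simp⟩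
    | succ n ih =>
      intro e e' hlt
      rcases ih e e' hlt with h | ⟨h, hz⟩
      · exact Or.inl (h.mono (sub n e) (sub n e'))
      · have n1 : ¬ ∃ m < n, e ∈ S m := fun ⟨m, hm, he⟩ => hz m hm e he ⟨le_refl _, hlt.le⟩
        have n2 : ¬ ∃ m < n, e' ∈ S m := fun ⟨m, hm, he⟩ => hz m hm e' he ⟨hlt.le, le_refl _⟩
        rw [hSt, hSt, if_neg n1, if_neg n2, ← h]
        rcases (hΦ n _ ((inv n e).2 n1)).2.2.2 e e' hlt with h' | ⟨h', hz'⟩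
        · exact Or.inl h'
        · refine Or.inr ⟨h', fun m hm => ?_⟩
          rcases Nat.lt_succ_iff_lt_or_eq.1 hm with h' | rfl
          · exact hz m h'
          · exact hz'
  have hN : ∀ e, ∃ m, e ∈ S m := fun e => by
    have : e ∈ ⋃ k, S k := by rw [hSu]; trivial
    simpa using this
  choose N hN using hN
  have stab : ∀ e k, St (N e + 1 + k) e = St (N e + 1) e := by
    intro e k
    induction k with
    | zero => rfl
    | succ k ih =>
      rw [← add_assoc, hSt, if_pos ⟨N e, by omega, hN e⟩, ih]
  refine ⟨fun e => St (N e + 1) e, fun e => ⟨(inv (N e + 1) e).1 ⟨N e, by omega, hN e⟩,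
    sub0 (N e + 1) e⟩, ?_⟩
  intro e e' hlt
  have e1 := stab e (N e')
  have e2 := stab e' (N e)
  rw [show N e' + 1 + N e = N e + 1 + N e' by omega] at e2
  rcases ord (N e + 1 + N e') e e' hlt with h | ⟨_, hz⟩
  · rw [e1, e2] at h; exact h
  · exact absurd ⟨le_refl _, hlt.le⟩ (hz (N e) (by omega) e (hN e))
end
end LV

namespace LV
universe u
open Code

section
variable {L : Type u} [LinearOrder L]

def SumReal {ι : Type u} (d : Bool) (a : Ordinal.{u}) (F : Set L → Prop) (H : ι → Set L → Prop)
    (A : Set L) : Prop :=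
  Reg a ∧ ∃ p : L → Ordinal.{u}, (∀ x ∈ A, p x < a) ∧
    (∀ x ∈ A, ∀ y ∈ A, p x < p y → dlt d x y) ∧
    (∀ ξ < a, FS F {x | x ∈ A ∧ p x = ξ}) ∧
    ∀ i, ∀ ζ < a, ∃ B ⊆ A, (∀ x ∈ B, ζ ≤ p x) ∧ (∃ ξ < a, ∀ x ∈ B, p x ≤ ξ) ∧ H i B

/-- `o` does not embed in direction `d` along `r` -/
def OrdSeq (d : Bool) (r : L → L) (A : Set L) (o : Ordinal.{u}) : Prop :=
  ∃ e : Ordinal.{u} → L, (∀ ξ < o, e ξ ∈ A) ∧ ∀ ξ < o, ∀ ζ < ξ, dlt d (r (e ζ)) (r (e ξ))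

def seg (A : Set L) (x y : L) : Set L := {z | z ∈ A ∧ x < z ∧ z < y}

def ShReal {ι : Type u} (a b : Ordinal.{u}) (F : Set L → Prop) (H : ι → Set L → Prop)
    (A : Set L) : Prop :=
  ∃ r : L → L, (∀ x ∈ A, ∀ y ∈ A, r x < r y → x < y) ∧ (∃ x ∈ A, ∃ y ∈ A, r x < r y) ∧
    (∀ x ∈ A, ∀ y ∈ A, r x < r y → ∃ z ∈ A, r x < r z ∧ r z < r y) ∧
    (∀ x ∈ A, FS F {y | y ∈ A ∧ r y = r x}) ∧
    (∀ i, ∀ x ∈ A, ∀ y ∈ A, r x < r y → ∃ B ⊆ seg A x y, H i B) ∧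
    ∀ d : Bool, (∀ o, OrdSeq d r A o → o < if d then a else b) ∧
      ∀ o < (if d then a else b), ∀ x ∈ A, ∀ y ∈ A, r x < r y → OrdSeq d r (seg A x y) o

def Real : Code.{u} → Set L → Prop
  | node .one _ _ ι _ => fun A => IsEmpty ι ∧ ∃ x, A = {x}
  | node .sp a _ _ c => SumReal true a (fun B => ∃ i, Real (c i) B)
      (fun i B => ∃ j, le (c i) (c j) ∧ Real (c j) B)
  | node .sm a _ _ c => SumReal false a (fun B => ∃ i, Real (c i) B)
      (fun i B => ∃ j, le (c i) (c j) ∧ Real (c j) B)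
  | node .sh a b _ c => ShReal a b (fun B => ∃ i, Real (c i) B)
      (fun i B => ∃ j, le (c i) (c j) ∧ Real (c j) B)
end

section
variable {L L' : Type u} [LinearOrder L] [LinearOrder L']

/-- Mostowski enumeration of a set with injective ordinal labels -/
lemma enum_set {E : Type u} (W : Set E) (hW : W.Nonempty) (p : E → Ordinal.{u})
    (hp : ∀ x ∈ W, ∀ y ∈ W, p x = p y → x = y) :
    ∃ (o : Ordinal.{u}) (rk : W → Ordinal.{u}) (e : Ordinal.{u} → E),
      (∀ w, rk w < o) ∧ (∀ w w' : W, p w < p w' → rk w < rk w') ∧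
      (∀ ξ < o, e ξ ∈ W) ∧ ∀ ξ < o, ∀ ζ < ξ, p (e ζ) < p (e ξ) := by
  classical
  let R : W → W → Prop := fun w w' => p w < p w'
  have : Std.Trichotomous R := ⟨fun w w' h1 h2 => Subtype.ext (hp _ w.2 _ w'.2
    (le_antisymm (not_lt.1 h2) (not_lt.1 h1)))⟩
  have : IsTrans W R := ⟨fun _ _ _ => lt_trans⟩
  have : IsWellFounded W R := ⟨InvImage.wf (fun w : W => p w) wellFounded_lt⟩
  have : IsWellOrder W R := { }
  obtain ⟨w0, hw0⟩ := hW
  refine ⟨Ordinal.type R, fun w => Ordinal.typein R w,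
    fun ξ => if h : ξ < Ordinal.type R then (Ordinal.enum R ⟨ξ, h⟩ : W) else w0, ?_, ?_, ?_, ?_⟩
  · exact fun w => Ordinal.typein_lt_type R w
  · exact fun w w' h => (Ordinal.typein_lt_typein R).2 h
  · intro ξ hξ; simp [hξ]
  · intro ξ hξ ζ hζ
    simp only [hξ, hζ.trans hξ, dif_pos]
    have := (Ordinal.enum_lt_enum (r := R) (o₁ := ⟨ζ, hζ.trans hξ⟩) (o₂ := ⟨ξ, hξ⟩)).2 hζ
    exact this

lemma sh_emb [Nonempty L'] (hσ : SigmaScattered L) {A : Set L} {A' : Set L'}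
    {r : L → L} {r' : L' → L'} {α α' : Bool → Ordinal.{u}} (haa : ∀ d, α d ≤ α' d)
    (hr : ∀ x ∈ A, ∀ y ∈ A, r x < r y → x < y) (hr' : ∀ x ∈ A', ∀ y ∈ A', r' x < r' y → x < y)
    (hnt : ∃ x ∈ A', ∃ y ∈ A', r' x < r' y)
    (hden : ∀ x ∈ A', ∀ y ∈ A', r' x < r' y → ∃ z ∈ A', r' x < r' z ∧ r' z < r' y)
    {F : Set L → Prop} (hF : ∀ x ∈ A, FS F {y | y ∈ A ∧ r y = r x})
    (hE : ∀ K, F K → ∀ x ∈ A', ∀ y ∈ A', r' x < r' y → Emb K (seg A' x y))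
    (hα : ∀ d o, OrdSeq d r A o → o < α d)
    (hα' : ∀ d, ∀ o < α' d, ∀ x ∈ A', ∀ y ∈ A', r' x < r' y → OrdSeq d r' (seg A' x y) o) :
    Emb A A' := by
  classical
  let E := ↥(r '' A)
  let JJ : Set (Set L') := {J | ∃ x ∈ A', ∃ y ∈ A', r' x < r' y ∧ J = seg A' x y}
  let pt : E → Set (Set L') := fun e => {B | Emb {y | y ∈ A ∧ r y = e} B}
  have hr2 : ∀ x ∈ A', ∀ y ∈ A', x ≤ y → r' x ≤ r' y := by
    intro x hx y hy h
    by_contra hc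
    exact not_lt_of_ge h (hr' y hy x hx (not_le.1 hc))
  have u1 : U1 JJ pt := by
    rintro J ⟨x, hx, y, hy, hxy, rfl⟩ ⟨_, e, he, rfl⟩
    refine ⟨_, ?_, subset_rfl⟩
    have key : ∀ K, FS F K → ∀ x ∈ A', ∀ y ∈ A', r' x < r' y → Emb K (seg A' x y) := by
      intro K hK
      induction hK with
      | nil => exact fun _ _ _ _ _ => Emb.empty _
      | cons h1 h2 h3 ih =>
        intro x hx y hy hxy
        obtain ⟨z, hz, hxz, hzy⟩ := hden x hx y hy hxy
        refine ((hE _ h1 x hx z hz hxz).union (ih z hz y hy hzy) h3 ?_).mono ?_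
        · exact fun a ha b hb => ha.2.2.trans hb.2.1
        · rintro a (ha | ha)
          · exact ⟨ha.1, ha.2.1, ha.2.2.trans (hr' _ hz _ hy hzy)⟩
          · exact ⟨ha.1, (hr' _ hx _ hz hxz).trans ha.2.1, ha.2.2⟩
    exact key _ (hF e he) x hx y hy hxy
  have u2 : U2 E JJ := by
    rintro d W p hp1 hp2 J ⟨x, hx, y, hy, hxy, rfl⟩
    rcases W.eq_empty_or_nonempty with rfl | hW
    · exact ⟨fun _ => ∅, by simp, by simp⟩
    obtain ⟨o, rk, e, ho, hrk, he1, he2⟩ := enum_set W hW p hp2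
    have ho' : o < α' d := by
      refine lt_of_lt_of_le (hα d o ?_) (haa d)
      have hc : ∀ q : E, ∃ z ∈ A, r z = q := fun q => q.2
      choose c hc1 hc2 using hc
      refine ⟨fun ξ => c (e ξ), fun ξ _ => hc1 _, fun ξ hξ ζ hζ => ?_⟩
      simp only [hc2]
      have := hp1 _ (he1 ζ (hζ.trans hξ)) _ (he1 ξ hξ) (he2 ξ hξ ζ hζ)
      cases d <;> simpa [dlt] using this
    obtain ⟨z, hz, hxz, hzy⟩ := hden x hx y hy hxy
    have hord : ∀ w w' : W, w < w' → if d then rk w < rk w' else rk w' < rk w := by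
      intro w w' hlt
      rcases lt_trichotomy (p w) (p w') with h | h | h
      · have h1 := hp1 _ w.2 _ w'.2 h
        cases d
        · simp [dlt] at h1; exact absurd h1 (not_lt_of_gt hlt)
        · simpa using hrk _ _ h
      · exact absurd (Subtype.ext (hp2 _ w.2 _ w'.2 h)) hlt.ne
      · have h1 := hp1 _ w'.2 _ w.2 h
        cases d
        · simpa using hrk _ _ h
        · simp [dlt] at h1; exact absurd h1 (not_lt_of_gt hlt)
    cases d with
    | true =>
      obtain ⟨e', e1, e2⟩ := hα' true o ho' x hx z hz hxz
      simp only [dlt, if_true] at e2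
      let up : Ordinal.{u} → L' := fun ξ => if Order.succ ξ < o then e' (Order.succ ξ) else y
      have hup : ∀ ξ < o, up ξ ∈ A' ∧ r' (e' ξ) < r' (up ξ) ∧ up ξ ≤ y := by
        intro ξ hξ
        by_cases h : Order.succ ξ < o
        · simp only [up, if_pos h]
          exact ⟨(e1 _ h).1, e2 _ h _ (Order.lt_succ ξ),
            ((e1 _ h).2.2.trans (hr' _ hz _ hy hzy)).le⟩
        · simp only [up, if_neg h]
          exact ⟨hy, (hr2 _ (e1 _ hξ).1 _ hz (e1 _ hξ).2.2.le).trans_lt hzy, le_refl _⟩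
      refine ⟨fun w => if h : w ∈ W then seg A' (e' (rk ⟨w, h⟩)) (up (rk ⟨w, h⟩)) else ∅, ?_, ?_⟩
      · intro w hw
        simp only [dif_pos hw]
        have h1 := hup _ (ho ⟨w, hw⟩)
        have h2 := e1 _ (ho ⟨w, hw⟩)
        refine ⟨⟨_, h2.1, _, h1.1, h1.2.1, rfl⟩, ?_⟩
        rintro v ⟨hv, hv1, hv2⟩
        exact ⟨hv, h2.2.1.trans hv1, hv2.trans_le h1.2.2⟩
      · intro w hw w' hw' hlt
        simp only [dif_pos hw, dif_pos hw']
        have h := hord ⟨w, hw⟩ ⟨w', hw'⟩ hlt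
        simp only [if_true] at h
        rintro v ⟨hv, hv1, hv2⟩ v' ⟨hv', hv1', hv2'⟩
        have hs : Order.succ (rk ⟨w, hw⟩) ≤ rk ⟨w', hw'⟩ := Order.succ_le_iff.2 h
        have hso := hs.trans_lt (ho ⟨w', hw'⟩)
        simp only [up, if_pos hso] at hv2
        refine hv2.trans (lt_of_le_of_lt ?_ hv1')
        rcases hs.eq_or_lt with heq | hlt'
        · rw [heq]
        · exact (hr' _ (e1 _ hso).1 _ (e1 _ (ho ⟨w', hw'⟩)).1 (e2 _ (ho ⟨w', hw'⟩) _ hlt')).le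
    | false =>
      obtain ⟨e', e1, e2⟩ := hα' false o ho' z hz y hy hzy
      simp only [dlt, Bool.false_eq_true, if_false] at e2
      let dn : Ordinal.{u} → L' := fun ξ => if Order.succ ξ < o then e' (Order.succ ξ) else x
      have hdn : ∀ ξ < o, dn ξ ∈ A' ∧ r' (dn ξ) < r' (e' ξ) ∧ x ≤ dn ξ := by
        intro ξ hξ
        by_cases h : Order.succ ξ < o
        · simp only [dn, if_pos h]
          exact ⟨(e1 _ h).1, e2 _ h _ (Order.lt_succ ξ),
            ((hr' _ hx _ hz hxz).trans (e1 _ h).2.1).le⟩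
        · simp only [dn, if_neg h]
          exact ⟨hx, hxz.trans_le (hr2 _ hz _ (e1 _ hξ).1 (e1 _ hξ).2.1.le), le_refl _⟩
      refine ⟨fun w => if h : w ∈ W then seg A' (dn (rk ⟨w, h⟩)) (e' (rk ⟨w, h⟩)) else ∅, ?_, ?_⟩
      · intro w hw
        simp only [dif_pos hw]
        have h1 := hdn _ (ho ⟨w, hw⟩)
        have h2 := e1 _ (ho ⟨w, hw⟩)
        refine ⟨⟨_, h1.1, _, h2.1, h1.2.1, rfl⟩, ?_⟩
        rintro v ⟨hv, hv1, hv2⟩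
        exact ⟨hv, h1.2.2.trans_lt hv1, hv2.trans h2.2.2⟩
      · intro w' hw' w hw hlt
        simp only [dif_pos hw, dif_pos hw']
        have h := hord ⟨w', hw'⟩ ⟨w, hw⟩ hlt
        simp only [Bool.false_eq_true, if_false] at h
        rintro v' ⟨hv', hv1', hv2'⟩ v ⟨hv, hv1, hv2⟩
        have hs : Order.succ (rk ⟨w, hw⟩) ≤ rk ⟨w', hw'⟩ := Order.succ_le_iff.2 h
        have hso := hs.trans_lt (ho ⟨w', hw'⟩)
        simp only [dn, if_pos hso] at hv1
        refine (lt_of_lt_of_le hv2' ?_).trans hv1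
        rcases hs.eq_or_lt with heq | hlt'
        · rw [heq]
        · exact (hr' _ (e1 _ (ho ⟨w', hw'⟩)).1 _ (e1 _ hso).1 (e2 _ (ho ⟨w', hw'⟩) _ hlt')).le
  have hσE : SigmaScattered E := by
    obtain ⟨S, hS1, hS2⟩ := hσ
    refine ⟨fun n => {e | ∃ x ∈ A, x ∈ S n ∧ r x = e}, ?_, ?_⟩
    · rw [Set.eq_univ_iff_forall]
      rintro ⟨_, x, hx, rfl⟩
      have : x ∈ ⋃ k, S k := by rw [hS1]; trivial
      obtain ⟨n, hn⟩ := Set.mem_iUnion.1 this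
      exact Set.mem_iUnion.2 ⟨n, x, hx, hn, rfl⟩
    · intro n
      refine ⟨fun φ => ?_⟩
      have : ∀ q, ∃ x ∈ A, x ∈ S n ∧ r x = ((φ q).1 : L) := fun q => (φ q).2
      choose x h1 h2 h3 using this
      refine (hS2 n).false (OrderEmbedding.ofStrictMono (fun q => (⟨x q, h2 q⟩ : S n)) ?_)
      intro q q' h
      refine hr _ (h1 q) _ (h1 q') ?_
      rw [h3, h3]
      exact φ.strictMono h
  obtain ⟨x, hx, y, hy, hxy⟩ := hnt
  obtain ⟨Fn, h1, h2⟩ := universal u1 u2 hσE (seg A' x y) ⟨x, hx, y, hy, hxy, rfl⟩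
  have h3 : ∀ e : E, Emb {y | y ∈ A ∧ r y = e} (Fn e) := fun e => (h1 e).1
  choose g hg1 hg2 using h3
  have hm : ∀ x (h : x ∈ A), (⟨r x, x, h, rfl⟩ : E) = ⟨r x, x, h, rfl⟩ := fun _ _ => rfl
  refine ⟨fun x => if h : x ∈ A then g ⟨r x, x, h, rfl⟩ x else Classical.arbitrary _, ?_, ?_⟩
  · intro x hx
    simp only [dif_pos hx]
    exact ((h1 _).2 (hg1 ⟨r x, x, hx, rfl⟩ x ⟨hx, rfl⟩)).1
  · intro x hx y hy hlt
    simp only [dif_pos hx, dif_pos hy]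
    rcases lt_trichotomy (r x) (r y) with h | h | h
    · exact h2 ⟨r x, x, hx, rfl⟩ ⟨r y, y, hy, rfl⟩ h _ (hg1 _ x ⟨hx, rfl⟩) _ (hg1 _ y ⟨hy, rfl⟩)
    · have he : (⟨r x, x, hx, rfl⟩ : E) = ⟨r y, y, hy, rfl⟩ := Subtype.ext h
      rw [he]
      exact hg2 ⟨r y, y, hy, rfl⟩ x ⟨hx, h⟩ y ⟨hy, rfl⟩ hlt
    · exact absurd hlt (not_lt_of_gt (hr _ hy _ hx h))

lemma Real.sub_piece {k : Kind} {a b : Ordinal.{u}} {ι : Type u} {c : ι → Code.{u}} {A : Set L}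
    (h : Real (node k a b ι c) A) (i : ι) : ∃ B ⊆ A, ∃ j, le (c i) (c j) ∧ Real (c j) B := by
  cases k with
  | one =>
    simp only [Real] at h
    exact h.1.elim i
  | sp =>
    simp only [Real] at h
    obtain ⟨hreg, p, -, -, -, h⟩ := h
    obtain ⟨B, hB, -, -, h⟩ := h i 0 hreg.1
    exact ⟨B, hB, h⟩
  | sm =>
    simp only [Real] at h
    obtain ⟨hreg, p, -, -, -, h⟩ := h
    obtain ⟨B, hB, -, -, h⟩ := h i 0 hreg.1
    exact ⟨B, hB, h⟩
  | sh =>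
    simp only [Real] at h
    obtain ⟨r, -, ⟨x, hx, y, hy, hxy⟩, -, -, h, -⟩ := h
    obtain ⟨B, hB, h⟩ := h i x hx y hy hxy
    exact ⟨B, fun z hz => (hB hz).1, h⟩

theorem sound [Nonempty L'] (hσ : SigmaScattered L) (t : Code.{u}) : ∀ (s : Code.{u}) (A : Set L)
    (A' : Set L'), le s t → Real s A → Real t A' → Emb A A' := by
  induction t with
  | node k a' b' ι' c' ih =>
  intro s A A' hle hA hA'
  rw [le_iff] at hle
  rcases hle with ⟨j, hj⟩ | ⟨e1, e2, e3, e4⟩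
  · obtain ⟨B, hB, j', hj', hr⟩ := hA'.sub_piece j
    exact (ih j' s A B (le_trans hj hj') hA hr).mono hB
  · cases s with
    | node k0 a b ι c =>
    simp only [kind] at e1
    subst e1
    have e2 : a ≤ a' := e2
    have e3 : b ≤ b' := e3
    have e4 : ∀ i : ι, ∃ j, le (c i) (c' j) := e4
    have step : ∀ (K : Set L) (B : Set L'), ∀ i j j', Real (c i) K → le (c i) (c' j) →
        le (c' j) (c' j') → Real (c' j') B → Emb K B := fun K B i j j' h1 h2 h3 h4 =>
      ih j' (c i) K B (le_trans h2 h3) h1 h4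
    cases k0 with
    | one =>
      simp only [Real] at hA hA'
      obtain ⟨-, x, rfl⟩ := hA
      obtain ⟨-, y, rfl⟩ := hA'
      refine ⟨fun _ => y, by simp, ?_⟩
      rintro x rfl z rfl h
      exact absurd h (lt_irrefl _)
    | sp =>
      simp only [Real] at hA hA'
      obtain ⟨hreg, p, p1, p2, p3, -⟩ := hA
      obtain ⟨hreg', p', -, p2', -, p4'⟩ := hA'
      refine sum_emb true e2 hreg' p1 p2 p2' p3 ?_
      rintro K ⟨i, hi⟩ ζ hζ
      obtain ⟨j, hj⟩ := e4 i
      obtain ⟨B, hB, h1, h2, j', hj', hr⟩ := p4' j ζ hζ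
      exact ⟨B, hB, h1, h2, step K B i j j' hi hj hj' hr⟩
    | sm =>
      simp only [Real] at hA hA'
      obtain ⟨hreg, p, p1, p2, p3, -⟩ := hA
      obtain ⟨hreg', p', -, p2', -, p4'⟩ := hA'
      refine sum_emb false e2 hreg' p1 p2 p2' p3 ?_
      rintro K ⟨i, hi⟩ ζ hζ
      obtain ⟨j, hj⟩ := e4 i
      obtain ⟨B, hB, h1, h2, j', hj', hr⟩ := p4' j ζ hζ
      exact ⟨B, hB, h1, h2, step K B i j j' hi hj hj' hr⟩
    | sh =>
      simp only [Real] at hA hA'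
      obtain ⟨r, r1, -, -, r4, -, r6⟩ := hA
      obtain ⟨r', r1', r2', r3', -, r5', r6'⟩ := hA'
      refine sh_emb hσ (α := fun d => if d then a else b) (α' := fun d => if d then a' else b')
        (fun d => by cases d <;> simpa) r1 r1' r2' r3' r4 ?_ (fun d => (r6 d).1) (fun d => (r6' d).2)
      rintro K ⟨i, hi⟩ x hx y hy hxy
      obtain ⟨j, hj⟩ := e4 i
      obtain ⟨B, hB, j', hj', hr⟩ := r5' j x hx y hy hxy
      exact (step K B i j j' hi hj hj' hr).mono hB
end
end LV

namespace LV
universe u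
open Code

lemma wqo_tail {X : Type*} (R : X → X → Prop) (hrefl : ∀ x, R x x)
    (htrans : ∀ x y z, R x y → R y z → R x z) (P : X → Set Code.{u})
    (hP : ∀ x y, R x y → P y ⊆ P x) (x0 : X) :
    ∃ x, R x0 x ∧ ∀ y, R x y → ∀ c ∈ P x, ∃ c' ∈ P y, le c c' := by
  by_contra hcon
  push Not at hcon
  have : ∀ x : {x // R x0 x}, ∃ y : {x // R x0 x}, R x.1 y.1 ∧ ∃ c ∈ P x.1, ∀ c' ∈ P y.1, ¬ le c c' := by
    rintro ⟨x, hx⟩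
    obtain ⟨y, h1, h2⟩ := hcon x hx
    exact ⟨⟨y, htrans _ _ _ hx h1⟩, h1, h2⟩
  obtain ⟨s, -, hs⟩ := exists_seq _ ⟨x0, hrefl x0⟩ this
  choose h1 c hc hc' using hs
  have hR : ∀ n k, R (s n).1 (s (n + k)).1 := by
    intro n k
    induction k with
    | zero => exact hrefl _
    | succ k ih => exact htrans _ _ _ ih (h1 _)
  obtain ⟨n, m, hnm, hle⟩ := code_wqo c
  refine hc' n (c m) (hP _ _ ?_ (hc m)) hle
  have := hR (n+1) (m - (n+1))
  rwa [show n + 1 + (m - (n+1)) = m by omega] at this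

lemma ord_tail {X : Type*} (R : X → X → Prop) (hrefl : ∀ x, R x x)
    (htrans : ∀ x y z, R x y → R y z → R x z) (f : X → Ordinal.{u})
    (hf : ∀ x y, R x y → f y ≤ f x) (x0 : X) : ∃ x, R x0 x ∧ ∀ y, R x y → f y = f x := by
  have hne : (f '' {x | R x0 x}).Nonempty := ⟨_, x0, hrefl x0, rfl⟩
  obtain ⟨x, hx, e⟩ := csInf_mem hne
  refine ⟨x, hx, fun y hy => le_antisymm (hf _ _ hy) ?_⟩
  rw [e]
  exact csInf_le' ⟨y, htrans _ _ _ hx hy, rfl⟩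

section
variable {L : Type u} [LinearOrder L]

lemma FS.mono' {P Q : Set L → Prop} {A : Set L} (hA : FS P A) (h : ∀ B ⊆ A, P B → Q B) :
    FS Q A := by
  induction hA with
  | nil => exact .nil
  | cons h1 _ h3 ih =>
    exact .cons (h _ Set.subset_union_left h1)
      (ih fun B hB => h B (hB.trans Set.subset_union_right)) h3

def RB (A : Set L) : Prop := ∃ t : Code.{u}, Real t A

open Classical in
noncomputable def cd (A : Set L) : Code.{u} :=
  if h : RB A then h.choose else node .one 0 0 PEmpty PEmpty.elim

lemma cd_spec {A : Set L} (h : RB A) : Real (cd A) A := by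
  unfold cd; rw [dif_pos h]; exact h.choose_spec

lemma RB_one (x : L) : RB ({x} : Set L) := by
  refine ⟨node .one 0 0 PEmpty PEmpty.elim, ?_⟩
  simp only [Real]
  exact ⟨inferInstance, x, rfl⟩

lemma RB_sum (d : Bool) (a : Ordinal.{u}) (ι : Type u) (c : ι → Code.{u}) (A : Set L)
    (h : SumReal d a (fun B => ∃ i, Real (c i) B) (fun i B => ∃ j, le (c i) (c j) ∧ Real (c j) B) A) :
    RB A := by
  cases d
  · refine ⟨node .sm a 0 ι c, ?_⟩
    simp only [Real]; exact h
  · refine ⟨node .sp a 0 ι c, ?_⟩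
    simp only [Real]; exact h

lemma sum_case (d : Bool) (a : Ordinal.{u}) (p : L → Ordinal.{u}) (A : Set L) (hreg : Reg a)
    (hpa : ∀ x ∈ A, p x < a) (hp : ∀ x ∈ A, ∀ y ∈ A, p x < p y → dlt d x y)
    (h1 : ∀ ξ < a, FS RB {x | x ∈ A ∧ p x = ξ}) (h2 : ∀ ξ < a, FS RB {x | x ∈ A ∧ p x < ξ}) :
    FS RB A := by
  classical
  obtain ⟨⟨ξ, hξ⟩, -, ht⟩ := wqo_tail (X := {ξ // ξ < a}) (fun x y => x ≤ y) (fun _ => _root_.le_rfl)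
    (fun _ _ _ => _root_.le_trans)
    (fun ξ => {t : Code.{u} | ∃ K ⊆ A, RB K ∧ (∀ x ∈ K, ξ.1 ≤ p x) ∧ (∃ η < a, ∀ x ∈ K, p x ≤ η) ∧
      t = cd K})
    (by
      rintro x y hxy t ⟨K, k1, k2, k3, k4⟩
      exact ⟨K, k1, k2, fun z hz => _root_.le_trans hxy (k3 z hz), k4⟩) ⟨0, hreg.1⟩
  let A1 : Set L := {x | x ∈ A ∧ ξ ≤ p x}
  have hA1 : RB A1 := by
    refine RB_sum d a {K : Set L // K ⊆ A ∧ RB K ∧ (∀ x ∈ K, ξ ≤ p x) ∧ ∃ η < a, ∀ x ∈ K, p x ≤ η}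
      (fun K => cd K.1) A1 ⟨hreg, p, fun x hx => hpa x hx.1, fun x hx y hy => hp x hx.1 y hy.1, ?_, ?_⟩
    · intro η hη
      by_cases hle : ξ ≤ η
      · have e : {x | x ∈ A1 ∧ p x = η} = {x | x ∈ A ∧ p x = η} := by
          ext x
          constructor
          · rintro ⟨h, h'⟩; exact ⟨h.1, h'⟩
          · rintro ⟨h, h'⟩; exact ⟨⟨h, h' ▸ hle⟩, h'⟩
        rw [e]
        refine (h1 η hη).mono' ?_
        intro B hB hRB
        refine ⟨⟨B, fun x hx => (hB hx).1, hRB, fun x hx => ?_, η, hη, fun x hx => (hB hx).2.le⟩,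
          cd_spec hRB⟩
        rw [(hB hx).2]; exact hle
      · have e : {x | x ∈ A1 ∧ p x = η} = ∅ := by
          ext x
          constructor
          · rintro ⟨h, h'⟩; exact hle (h' ▸ h.2)
          · rintro ⟨⟩
        rw [e]; exact .nil
    · rintro ⟨K, k1, k2, k3, k4⟩ ζ hζ
      obtain ⟨_, ⟨K', m1, m2, m3, m4, rfl⟩, hle⟩ := ht ⟨max ξ ζ, max_lt hξ hζ⟩
        (Subtype.mk_le_mk.2 (le_max_left _ _)) (cd K) ⟨K, k1, k2, k3, k4, rfl⟩
      have m3' : ∀ x ∈ K', ξ ≤ p x := fun x hx => _root_.le_trans (le_max_left _ _) (m3 x hx)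
      exact ⟨K', fun x hx => ⟨m1 hx, m3' x hx⟩,
        fun x hx => _root_.le_trans (le_max_right _ _) (m3 x hx), m4,
        ⟨K', m1, m2, m3', m4⟩, hle, cd_spec m2⟩
  have hlow := h2 ξ hξ
  cases d with
  | true =>
    have e : A = {x | x ∈ A ∧ p x < ξ} ∪ A1 := by
      ext x
      constructor
      · intro hx
        rcases lt_or_ge (p x) ξ with h | h
        · exact Or.inl ⟨hx, h⟩
        · exact Or.inr ⟨hx, h⟩
      · rintro (h | h) <;> exact h.1
    rw [e]
    refine hlow.append (.single hA1) ?_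
    rintro x ⟨hx, hx'⟩ y ⟨hy, hy'⟩
    simpa [dlt] using hp x hx y hy (hx'.trans_le hy')
  | false =>
    have e : A = A1 ∪ {x | x ∈ A ∧ p x < ξ} := by
      ext x
      constructor
      · intro hx
        rcases lt_or_ge (p x) ξ with h | h
        · exact Or.inr ⟨hx, h⟩
        · exact Or.inl ⟨hx, h⟩
      · rintro (h | h) <;> exact h.1
    rw [e]
    refine (FS.single hA1).append hlow ?_
    rintro y ⟨hy, hy'⟩ x ⟨hx, hx'⟩
    simpa [dlt] using hp x hx y hy (hx'.trans_le hy')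

lemma OrdSeq.mono {d : Bool} {r : L → L} {A B : Set L} {o o' : Ordinal.{u}} (h : OrdSeq d r A o)
    (hA : A ⊆ B) (ho : o' ≤ o) : OrdSeq d r B o' := by
  obtain ⟨e, h1, h2⟩ := h
  exact ⟨e, fun ξ hξ => hA (h1 ξ (hξ.trans_le ho)), fun ξ hξ => h2 ξ (hξ.trans_le ho)⟩

noncomputable def alpha (d : Bool) (r : L → L) (A : Set L) : Ordinal.{u} :=
  sInf {o | ¬ OrdSeq d r A o}

lemma exists_not_ordSeq (d : Bool) (r : L → L) (A : Set L) : ∃ o, ¬ OrdSeq d r A o := by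
  refine ⟨Ordinal.type (WellOrderingRel (α := Set L)), ?_⟩
  rintro ⟨e, -, h⟩
  have hinj : Function.Injective
      (fun x : Set L => e (Ordinal.typein (WellOrderingRel (α := Set L)) x)) := by
    have aux : ∀ x y : Set L, WellOrderingRel x y →
        e (Ordinal.typein WellOrderingRel x) ≠ e (Ordinal.typein WellOrderingRel y) := by
      intro x y hxy he
      have := h (Ordinal.typein WellOrderingRel y) (Ordinal.typein_lt_type _ y)
        (Ordinal.typein WellOrderingRel x) ((Ordinal.typein_lt_typein _).2 hxy)
      rw [he] at this
      cases d <;> simp [dlt] at this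
    intro x y hxy
    rcases trichotomous_of (WellOrderingRel (α := Set L)) x y with h | h | h
    · exact absurd hxy (aux x y h)
    · exact h
    · exact absurd hxy.symm (aux y x h)
  exact Function.cantor_injective _ hinj

lemma lt_alpha {d : Bool} {r : L → L} {A : Set L} {o : Ordinal.{u}} :
    o < alpha d r A ↔ OrdSeq d r A o := by
  constructor
  · intro h
    by_contra hn
    exact not_lt_of_ge (csInf_le' hn) h
  · intro h
    by_contra hn
    have := csInf_mem (s := {o | ¬ OrdSeq d r A o}) (exists_not_ordSeq d r A)
    exact this (h.mono subset_rfl (not_lt.1 hn))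

lemma alpha_mono {d : Bool} {r : L → L} {A B : Set L} (h : A ⊆ B) :
    alpha d r A ≤ alpha d r B := by
  by_contra hn
  have h1 := lt_alpha.1 (not_le.1 hn)
  exact lt_irrefl _ (lt_alpha.2 (h1.mono h _root_.le_rfl))

theorem structure_thm : FS RB (Set.univ : Set L) := by
  classical
  obtain ⟨r, hr, hden, hG1, hG2⟩ := hausdorff (M := L) (FS RB) .nil (fun x => .single (RB_one x))
    (fun A B hA hB h => hA.append hB h) sum_case
  have hrl : ∀ x y, r x < r y → x < y := by
    intro x y h
    by_contra hc
    exact not_lt_of_ge (hr (not_lt.1 hc)) h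
  refine hG1 _ Set.ordConnected_univ ?_
  by_contra hcon
  push Not at hcon
  obtain ⟨x0, y0, h0⟩ : ∃ x y, r x < r y := by
    obtain ⟨x, -, y, -, h⟩ := hcon
    rcases lt_or_gt_of_ne h with h | h
    · exact ⟨_, _, h⟩
    · exact ⟨_, _, h⟩
  let X := {q : L × L // r q.1 < r q.2}
  let R : X → X → Prop := fun q q' => q.1.1 ≤ q'.1.1 ∧ q'.1.2 ≤ q.1.2
  have hrefl : ∀ q, R q q := fun q => ⟨_root_.le_rfl, _root_.le_rfl⟩
  have htrans : ∀ q q' q'', R q q' → R q' q'' → R q q'' := fun q q' q'' h h' =>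
    ⟨h.1.trans h'.1, h'.2.trans h.2⟩
  let sg : X → Set L := fun q => seg Set.univ q.1.1 q.1.2
  have hsg : ∀ q q', R q q' → sg q' ⊆ sg q := fun q q' h z hz =>
    ⟨trivial, h.1.trans_lt hz.2.1, hz.2.2.trans_le h.2⟩
  obtain ⟨q1, -, hq1⟩ := ord_tail R hrefl htrans (fun q => alpha true r (sg q))
    (fun q q' h => alpha_mono (hsg q q' h)) ⟨(x0, y0), h0⟩
  obtain ⟨q2, hq12, hq2⟩ := ord_tail R hrefl htrans (fun q => alpha false r (sg q))
    (fun q q' h => alpha_mono (hsg q q' h)) q1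
  obtain ⟨q, hq23, hq⟩ := wqo_tail R hrefl htrans
    (fun q => {t : Code.{u} | ∃ K ⊆ sg q, RB K ∧ t = cd K})
    (by
      rintro q q' h t ⟨K, k1, k2⟩
      exact ⟨K, k1.trans (hsg q q' h), k2⟩) q2
  have hα : ∀ d, ∀ q', R q q' → alpha d r (sg q') = alpha d r (sg q) := by
    intro d q' h
    cases d
    · rw [hq2 q' (htrans _ _ _ hq23 h), hq2 q hq23]
    · rw [hq1 q' (htrans _ _ _ hq12 (htrans _ _ _ hq23 h)), hq1 q (htrans _ _ _ hq12 hq23)]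
  obtain ⟨⟨x, y⟩, hxy⟩ := q
  have hxy : r x < r y := hxy
  have hlt := hrl x y hxy
  refine hxy.ne (hG2 x y hlt.le ?_)
  intro B hB hBc
  have single : ∀ z, FS RB (B ∩ {z}) := by
    intro z
    by_cases hz : z ∈ B
    · rw [Set.inter_eq_self_of_subset_right (by simpa using hz)]
      exact .single (RB_one z)
    · rw [Set.inter_singleton_eq_empty.2 hz]; exact .nil
  let B0 : Set L := B ∩ Set.Ioo x y
  have hB0c : B0.OrdConnected := hBc.inter Set.ordConnected_Ioo
  have hB0 : FS RB B0 := by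
    by_cases hone : ∀ v ∈ B0, ∀ w ∈ B0, r v = r w
    · exact hG1 B0 hB0c hone
    push Not at hone
    have hnt : ∃ v ∈ B0, ∃ w ∈ B0, r v < r w := by
      obtain ⟨v, hv, w, hw, h⟩ := hone
      rcases lt_or_gt_of_ne h with h | h
      · exact ⟨v, hv, w, hw, h⟩
      · exact ⟨w, hw, v, hv, h⟩
    apply FS.single
    let ι := {K : Set L // K ⊆ seg Set.univ x y ∧ RB K}
    refine ⟨node .sh (alpha true r (seg Set.univ x y)) (alpha false r (seg Set.univ x y)) ι
      (fun K => cd K.1), ?_⟩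
    simp only [Real]
    have hsub : ∀ v ∈ B0, ∀ w ∈ B0, seg Set.univ v w ⊆ seg B0 v w := fun v hv w hw z hz =>
      ⟨hB0c.out hv hw ⟨hz.2.1.le, hz.2.2.le⟩, hz.2⟩
    have hpair : ∀ v ∈ B0, ∀ w ∈ B0, ∀ h : r v < r w, R ⟨(x, y), hxy⟩ ⟨(v, w), h⟩ :=
      fun v hv w hw h => ⟨hv.2.1.le, hw.2.2.le⟩
    refine ⟨r, fun v _ w _ => hrl v w, hnt, ?_, ?_, ?_, ?_⟩
    · intro v hv w hw h
      obtain ⟨z, h1, h2⟩ := hden v w h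
      exact ⟨z, hB0c.out hv hw ⟨(hrl _ _ h1).le, (hrl _ _ h2).le⟩, h1, h2⟩
    · intro v hv
      have : FS RB {w | w ∈ B0 ∧ r w = r v} := by
        refine hG1 _ ⟨?_⟩ ?_
        · rintro w ⟨hw, ew⟩ w' ⟨hw', ew'⟩ z hz
          exact ⟨hB0c.out hw hw' hz, le_antisymm (ew' ▸ hr hz.2) (ew ▸ hr hz.1)⟩
        · rintro w ⟨hw, ew⟩ w' ⟨hw', ew'⟩
          rw [ew, ew']
      refine this.mono' ?_
      intro C hC hRC
      exact ⟨⟨C, fun z hz => ⟨trivial, (hC hz).1.2⟩, hRC⟩, cd_spec hRC⟩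
    · rintro ⟨K, k1, k2⟩ v hv w hw h
      obtain ⟨_, ⟨K', m1, m2, rfl⟩, hle⟩ := hq _ (hpair v hv w hw h) (cd K) ⟨K, k1, k2, rfl⟩
      exact ⟨K', m1.trans (hsub v hv w hw), ⟨K', m1.trans (hsg _ _ (hpair v hv w hw h)), m2⟩, hle,
        cd_spec m2⟩
    · intro d
      have e : (if d then alpha true r (seg Set.univ x y) else alpha false r (seg Set.univ x y))
          = alpha d r (seg Set.univ x y) := by cases d <;> simp
      rw [e]
      constructor
      · intro o ho
        exact lt_alpha.2 (ho.mono (fun z hz => ⟨trivial, hz.2⟩) _root_.le_rfl)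
      · intro o ho v hv w hw h
        have := hα d _ (hpair v hv w hw h)
        simp only [sg] at this
        rw [← this] at ho
        exact (lt_alpha.1 ho).mono (hsub v hv w hw) _root_.le_rfl
  have e : B = (B ∩ {x}) ∪ (B0 ∪ (B ∩ {y})) := by
    ext z
    constructor
    · intro hz
      rcases (hB hz).1.eq_or_lt with h | h
      · exact Or.inl ⟨hz, h.symm⟩
      rcases (hB hz).2.eq_or_lt with h' | h'
      · exact Or.inr (Or.inr ⟨hz, h'⟩)
      · exact Or.inr (Or.inl ⟨hz, h, h'⟩)
    · rintro (h | h | h) <;> exact h.1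
  rw [e]
  refine (single x).append (hB0.append (single y) ?_) ?_
  · rintro v hv w ⟨_, rfl⟩
    exact hv.2.2
  · rintro v ⟨_, rfl⟩ w (hw | ⟨_, rfl⟩)
    · exact hw.2.1
    · exact hlt
end
end LV

namespace LV
universe u

section
variable {L L' : Type u} [LinearOrder L] [LinearOrder L']

/-- finite ordered concatenation with prescribed codes -/
inductive FSL {L : Type u} [LinearOrder L] : List Code.{u} → Set L → Prop
  | nil : FSL [] ∅
  | cons {A B : Set L} {t : Code.{u}} {l : List Code.{u}} : Real t A → FSL l B →
      (∀ x ∈ A, ∀ y ∈ B, x < y) → FSL (t :: l) (A ∪ B)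

lemma FSL.exists {A : Set L} (h : FS RB A) : ∃ l, FSL l A := by
  induction h with
  | nil => exact ⟨_, .nil⟩
  | cons h1 _ h3 ih =>
    obtain ⟨t, ht⟩ := h1
    obtain ⟨l, hl⟩ := ih
    exact ⟨_, .cons ht hl h3⟩

lemma FSL.emb [Nonempty L'] (hσ : SigmaScattered L) {l l' : List Code.{u}}
    (h : List.SublistForall₂ Code.le l l') :
    ∀ {A : Set L} {A' : Set L'}, FSL l A → FSL l' A' → Emb A A' := by
  induction h with
  | nil =>
    intro A A' h1 h2
    cases h1
    exact Emb.empty _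
  | cons h _ ih =>
    intro A A' h1 h2
    cases h1 with
    | cons a1 a2 a3 =>
    cases h2 with
    | cons b1 b2 b3 =>
    exact (sound hσ _ _ _ _ h a1 b1).union (ih a2 b2) a3 b3
  | cons_right _ ih =>
    intro A A' h1 h2
    cases h2 with
    | cons b1 b2 b3 => exact (ih h1 b2).mono Set.subset_union_right
end

instance : IsPreorder Code.{u} Code.le where
  refl := Code.le_rfl
  trans _ _ _ := Code.le_trans

theorem laver (L : ℕ → Type u) [∀ n, LinearOrder (L n)] (hσ : ∀ n, SigmaScattered (L n)) :
    ∃ n m, n < m ∧ Nonempty (L n ↪o L m) := by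
  by_cases hne : ∀ n, Nonempty (L n)
  · choose l hl using fun n => FSL.exists (structure_thm (L := L n))
    have hp : (Set.univ : Set Code.{u}).PartiallyWellOrderedOn Code.le := by
      intro f
      exact code_wqo (fun n => (f n).1)
    obtain ⟨n, m, hnm, h⟩ :=
      hp.partiallyWellOrderedOn_sublistForall₂ Code.le
        (fun n => ⟨l n, fun _ _ => Set.mem_univ _⟩)
    have := hne m
    obtain ⟨f, -, hf⟩ := FSL.emb (hσ n) h (hl n) (hl m)
    exact ⟨n, m, hnm, ⟨OrderEmbedding.ofStrictMono f fun x y hxy => hf x trivial y trivial hxy⟩⟩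
  · push Not at hne
    obtain ⟨n, hn⟩ := hne
    exact ⟨n, n + 1, n.lt_succ_self,
      ⟨OrderEmbedding.ofStrictMono (fun x => (hn.false x).elim) fun x => (hn.false x).elim⟩⟩

end LV

namespace LV
universe u v

lemma main_inj {I : Type v} (L : I → Type u) [∀ i, LinearOrder (L i)]
    (hσ : ∀ i, SigmaScattered (L i))
    (hfto : ¬ ∃ J : Set I, J.Infinite ∧ ∀ i ∈ J, ∀ j ∈ J, Nonempty (L i ↪o L j))
    (p : I → Prop) (g : {i // p i} → {i // p i}) (hg : Function.Surjective g)
    (hemb : ∀ i, Nonempty (L i.1 ↪o L (g i).1)) : Function.Injective g := by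
  obtain ⟨h, hh⟩ := hg.hasRightInverse
  have hdec : ∀ i n k, Nonempty (L (h^[n + k] i).1 ↪o L (h^[n] i).1) := by
    intro i n k
    induction k with
    | zero => exact ⟨RelEmbedding.refl _⟩
    | succ k ih =>
      obtain ⟨e⟩ := ih
      obtain ⟨e'⟩ := hemb (h^[n + (k + 1)] i)
      have : g (h^[n + (k + 1)] i) = h^[n + k] i := by
        rw [← add_assoc, Function.iterate_succ_apply']
        exact hh _
      rw [this] at e'
      exact ⟨e'.trans e⟩
  have hper : ∀ i, ∃ k, 0 < k ∧ g^[k] i = i := by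
    intro i
    have hninj : ¬ Function.Injective (fun n => h^[n] i) := by
      intro hinj
      let s : ℕ → I := fun n => (h^[n] i).1
      have sinj : Function.Injective s := Subtype.val_injective.comp hinj
      let r : ℕ → ℕ → Prop := fun a b => Nonempty (L (s a) ↪o L (s b))
      have : IsTrans ℕ r := ⟨fun _ _ _ ⟨a⟩ ⟨b⟩ => ⟨a.trans b⟩⟩
      obtain ⟨φ, hφ⟩ := exists_increasing_or_nonincreasing_subseq r (fun n => n)
      rcases hφ with hφ | hφ
      · apply hfto
        refine ⟨Set.range (fun n => s (φ n)),
          Set.infinite_range_of_injective (sinj.comp φ.injective), ?_⟩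
        rintro _ ⟨n, rfl⟩ _ ⟨m, rfl⟩
        rcases lt_trichotomy n m with hnm | rfl | hnm
        · exact hφ n m hnm
        · exact ⟨RelEmbedding.refl _⟩
        · have := hdec i (φ m) (φ n - φ m)
          rwa [Nat.add_sub_cancel' (φ.monotone hnm.le)] at this
      · obtain ⟨n, m, hnm, h⟩ := laver (fun n => L (s (φ n))) (fun n => hσ _)
        exact hφ n m hnm h
    have hgh : ∀ n, g^[n] (h^[n] i) = i := fun n => (hh.iterate n) i
    simp only [Function.Injective, not_forall] at hninj
    obtain ⟨n, m, he, hne⟩ := hninj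
    have key : ∀ n m, n < m → h^[n] i = h^[m] i → ∃ k, 0 < k ∧ g^[k] i = i := by
      intro n m hnm he
      refine ⟨m - n, by omega, ?_⟩
      have h1 := hgh m
      rw [← he] at h1
      have h2 := hgh n
      have e : m = (m - n) + n := by omega
      rw [e, Function.iterate_add_apply, h2] at h1
      exact h1
    rcases lt_or_gt_of_ne hne with hnm | hnm
    · exact key n m hnm he
    · exact key m n hnm he.symm
  intro x y hxy
  obtain ⟨k, hk, hkx⟩ := hper x
  obtain ⟨l, hl, hly⟩ := hper y
  have hx : g^[k * l] x = x := (Function.IsPeriodicPt.mul_const hkx l)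
  have hy : g^[k * l] y = y := (Function.IsPeriodicPt.const_mul hly k)
  obtain ⟨q, hq⟩ : ∃ q, k * l = q + 1 := ⟨k * l - 1, by have := Nat.mul_pos hk hl; omega⟩
  rw [hq, Function.iterate_succ_apply] at hx hy
  rw [← hx, ← hy, hxy]

theorem main {I : Type v} (L : I → Type u) [∀ i, LinearOrder (L i)]
    (hσ : ∀ i, SigmaScattered (L i))
    (hfto : ¬ ∃ J : Set I, J.Infinite ∧ ∀ i ∈ J, ∀ j ∈ J, Nonempty (L i ↪o L j)) :
    Reversible (Σ i, L i) := by
  classical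
  intro f hf hmono
  have hle : ∀ {x y : Σ i, L i}, x ≤ y → x.1 = y.1 := by
    rintro _ _ ⟨i, a, b, h⟩; rfl
  have hcomp : ∀ i (a b : L i), (f ⟨i, a⟩).1 = (f ⟨i, b⟩).1 := by
    intro i a b
    rcases le_total a b with h | h
    · exact hle (hmono (Sigma.mk_le_mk_iff.2 h))
    · exact (hle (hmono (Sigma.mk_le_mk_iff.2 h))).symm
  let g : {i // Nonempty (L i)} → {i // Nonempty (L i)} := fun i =>
    ⟨(f ⟨i.1, i.2.some⟩).1, ⟨(f ⟨i.1, i.2.some⟩).2⟩⟩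
  have hgv : ∀ i (a : L i), (f ⟨i, a⟩).1 = (g ⟨i, ⟨a⟩⟩).1 := fun i a => hcomp i _ _
  have hsurj : Function.Surjective g := by
    rintro ⟨j, ⟨b⟩⟩
    obtain ⟨⟨i, a⟩, ha⟩ := hf.2 ⟨j, b⟩
    refine ⟨⟨i, ⟨a⟩⟩, Subtype.ext ?_⟩
    rw [← hgv i a, ha]
  have hemb : ∀ i, Nonempty (L i.1 ↪o L (g i).1) := by
    rintro ⟨i, hi⟩
    have hex : ∀ a : L i, ∃ b : L (g ⟨i, hi⟩).1, f ⟨i, a⟩ = ⟨_, b⟩ := by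
      intro a
      have h := hgv i a
      generalize f ⟨i, a⟩ = z at h
      obtain ⟨j, b⟩ := z
      change j = _ at h
      subst h
      exact ⟨b, rfl⟩
    choose e he using hex
    refine ⟨OrderEmbedding.ofStrictMono e ?_⟩
    intro a b hab
    have h1 : f ⟨i, a⟩ ≤ f ⟨i, b⟩ := hmono (Sigma.mk_le_mk_iff.2 hab.le)
    rw [he, he, Sigma.mk_le_mk_iff] at h1
    refine lt_of_le_of_ne h1 fun h2 => ?_
    have h3 : f ⟨i, a⟩ = f ⟨i, b⟩ := by rw [he, he, h2]
    have h4 := hf.1 h3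
    simp only [Sigma.mk.injEq, heq_eq_eq, true_and] at h4
    exact hab.ne h4
  have hinj := main_inj L hσ hfto _ g hsurj hemb
  rintro ⟨i, a⟩ ⟨j, b⟩ hxy
  have h1 := hle hxy
  rw [hgv, hgv] at h1
  have h2 := congrArg Subtype.val (hinj (Subtype.ext h1))
  change i = j at h2
  subst h2
  rcases le_total a b with h | h
  · exact Sigma.mk_le_mk_iff.2 h
  · have h3 := hmono (Sigma.mk_le_mk_iff.2 h)
    exact (hf.1 (_root_.le_antisymm hxy h3)).le

end LV


/-- If L_i, i ∈ I, are (pairwise disjoint) σ-scattered linear orders whose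
sequence of bi-embeddability classes is finite-to-one (no infinite J ⊆ I with L_i ⇄ L_j
for all i, j ∈ J), then the disjoint union poset ⋃_{i∈I} L_i is reversible. -/
theorem stmt10 {I : Type*} (L : I → Type*) [∀ i, LinearOrder (L i)]
    (hσ : ∀ i, SigmaScattered (L i))
    (hfto : ¬ ∃ J : Set I, J.Infinite ∧ ∀ i ∈ J, ∀ j ∈ J, Nonempty (L i ↪o L j)) :
    Reversible (Σ i, L i) := by
  exact LV.main L hσ hfto
end
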